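/- arXiv:1405.2533 — 9 statements merged into one kernel-verified Lean document; each statement's English description precedes it below -/
import Mathlib

section
/- Let p₁, p₂ : Fin 3 → L be such that each component p₁ i lies in the intermediate field IntermediateField.adjoin K {t₁} and each component p₂ i lies in IntermediateField.adjoin K {t₂}. If the sum parametrization is proper, i.e. IntermediateField.adjoin K {p₁ 0 + p₂ 0, p₁ 1 + p₂ 1, p₁ 2 + p₂ 2} = ⊤, then both factors are proper: IntermediateField.adjoin K {p₁ 0, p₁ 1, p₁ 2} = IntermediateField.adjoin K {t₁} and IntermediateField.adjoin K {p₂ 0, p₂ 1, p₂ 2} = IntermediateField.adjoin K {t₂}. (Proposition 2.1, statement 1: if the translational parametrization P = P₁ + P₂ is proper, then P₁ and P₂ are both proper.) -/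
noncomputable section

/-- The rational function field `K(t₁,t₂)`, realized as the fraction field of
`MvPolynomial (Fin 2) K`. -/
abbrev Lfield (K : Type*) [Field K] : Type _ :=
  FractionRing (MvPolynomial (Fin 2) K)

/-- The image of the first variable `t₁` in `K(t₁,t₂)`. -/
def t₁ (K : Type*) [Field K] : Lfield K :=
  algebraMap (MvPolynomial (Fin 2) K) (Lfield K) (MvPolynomial.X 0)

/-- The image of the second variable `t₂` in `K(t₁,t₂)`. -/
def t₂ (K : Type*) [Field K] : Lfield K :=
  algebraMap (MvPolynomial (Fin 2) K) (Lfield K) (MvPolynomial.X 1)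

open IntermediateField Polynomial in
/-- If `A ≤ B` and `y` is transcendental over `B`, then `A(y) ∩ B = A`. -/
theorem IntermediateField.mem_of_mem_sup_adjoin_of_transcendental {F E : Type*} [Field F] [Field E]
    [Algebra F E] {A B : IntermediateField F E} (hAB : A ≤ B) {x y : E}
    (hy : Transcendental B y) (hxB : x ∈ B) (hx : x ∈ A ⊔ adjoin F {y}) : x ∈ A := by
  rw [← restrictScalars_adjoin_eq_sup, mem_restrictScalars, mem_adjoin_simple_iff] at hx
  obtain ⟨r, s, hrs⟩ := hx
  by_cases hs : aeval y s = 0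
  · simp [hrs, hs]
  have haeval (q : A[X]) : aeval y (q.map (inclusion hAB).toRingHom) = aeval y q := by
    rw [aeval_def, eval₂_map, aeval_def]
    rfl
  have hpoly : C (⟨x, hxB⟩ : B) * s.map (inclusion hAB).toRingHom =
      r.map (inclusion hAB).toRingHom := by
    apply transcendental_iff_injective.mp hy
    rw [map_mul, haeval, haeval, aeval_C]
    exact (eq_div_iff hs).mp hrs
  have hs0 : s ≠ 0 := by
    rintro rfl
    simp at hs
  have hcoeff : x * (s.leadingCoeff : E) = (r.coeff s.natDegree : E) := by
    have h := congrArg (fun q : B[X] ↦ q.coeff s.natDegree) hpoly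
    simp only [coeff_C_mul, coeff_map] at h
    exact congrArg (Subtype.val : B → E) h
  have hlead : (s.leadingCoeff : E) ≠ 0 := by simpa using hs0
  rw [eq_div_of_mul_eq hlead hcoeff]
  exact div_mem (SetLike.coe_mem _) (SetLike.coe_mem _)

open IntermediateField in
/-- If `q₀, q₁, q₂` lie in `F(y)`, their sums with `p₀, p₁, p₂ ∈ F(x)` generate a field containing
`x`, and `y` is transcendental over `F(x)`, then `F(p₀, p₁, p₂) = F(x)`. -/
theorem adjoin_eq_adjoin_simple_of_mem_adjoin_add {F E : Type*} [Field F] [Field E]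
    [Algebra F E] {x y : E} (hy : Transcendental (adjoin F {x}) y) (p q : Fin 3 → E)
    (hp : ∀ i, p i ∈ adjoin F {x}) (hq : ∀ i, q i ∈ adjoin F {y})
    (hx : x ∈ adjoin F {p 0 + q 0, p 1 + q 1, p 2 + q 2}) :
    adjoin F {p 0, p 1, p 2} = adjoin F {x} := by
  have hle : adjoin F {p 0, p 1, p 2} ≤ adjoin F {x} := by
    rw [adjoin_le_iff]
    rintro _ (rfl | rfl | rfl) <;> exact hp _
  refine le_antisymm hle (adjoin_simple_le_iff.mpr ?_)
  refine mem_of_mem_sup_adjoin_of_transcendental hle hy (mem_adjoin_simple_self F x) ?_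
  refine adjoin_le_iff.mpr ?_ hx
  have hmem (i : Fin 3) (hi : p i ∈ ({p 0, p 1, p 2} : Set E)) :
      p i + q i ∈ adjoin F {p 0, p 1, p 2} ⊔ adjoin F {y} :=
    add_mem ((le_sup_left : adjoin F {p 0, p 1, p 2} ≤ _) (subset_adjoin F _ hi))
      ((le_sup_right : adjoin F {y} ≤ _) (hq i))
  rintro _ (rfl | rfl | rfl) <;> exact hmem _ (by simp)

theorem transcendental_adjoin_algebraMap_X (K : Type*) [Field K] {σ : Type*} {i j : σ}
    (hij : i ≠ j) :
    Transcendental (IntermediateField.adjoin K {algebraMap (MvPolynomial σ K)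
      (FractionRing (MvPolynomial σ K)) (MvPolynomial.X i)})
      (algebraMap (MvPolynomial σ K) (FractionRing (MvPolynomial σ K)) (MvPolynomial.X j)) := by
  have hind : AlgebraicIndependent K (fun k : σ ↦ algebraMap (MvPolynomial σ K)
      (FractionRing (MvPolynomial σ K)) (MvPolynomial.X k)) :=
    (MvPolynomial.algebraicIndependent_X σ K).map'
      (f := IsScalarTower.toAlgHom K (MvPolynomial σ K) (FractionRing (MvPolynomial σ K)))
      (IsFractionRing.injective _ _)
  rw [IntermediateField.transcendental_adjoin_iff]
  have h := hind.transcendental_adjoin (s := {i}) (i := j) (by simpa using hij.symm)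
  rwa [Set.image_singleton] at h

/-- Proposition 2.1, statement 1: if the translational parametrization
`P = P₁ + P₂` is proper, then `P₁` and `P₂` are both proper. -/
theorem properness_of_factors (K : Type*) [Field K] [IsAlgClosed K] [CharZero K]
    (p₁ p₂ : Fin 3 → Lfield K)
    (h₁ : ∀ i, p₁ i ∈ IntermediateField.adjoin K {t₁ K})
    (h₂ : ∀ i, p₂ i ∈ IntermediateField.adjoin K {t₂ K})
    (hproper : IntermediateField.adjoin K
      {p₁ 0 + p₂ 0, p₁ 1 + p₂ 1, p₁ 2 + p₂ 2} = ⊤) :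
    IntermediateField.adjoin K {p₁ 0, p₁ 1, p₁ 2} = IntermediateField.adjoin K {t₁ K} ∧
    IntermediateField.adjoin K {p₂ 0, p₂ 1, p₂ 2} = IntermediateField.adjoin K {t₂ K} := by
  refine ⟨adjoin_eq_adjoin_simple_of_mem_adjoin_add
    (transcendental_adjoin_algebraMap_X K (by decide)) p₁ p₂ h₁ h₂ ?_,
    adjoin_eq_adjoin_simple_of_mem_adjoin_add
    (transcendental_adjoin_algebraMap_X K (by decide)) p₂ p₁ h₂ h₁ ?_⟩
  · rw [hproper]
    exact IntermediateField.mem_top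
  · simp only [add_comm (p₂ _), hproper]
    exact IntermediateField.mem_top
end
end

section
/- Let f ∈ MvPolynomial (Fin 3) K be irreducible. Suppose there exist p₁, p₂ : Fin 3 → RatFunc K such that the tuple i ↦ ι₁(p₁ i) + ι₂(p₂ i) parametrizes the surface V(f). Then there exist q₁, q₂ : Fin 3 → RatFunc K, both proper, such that the tuple i ↦ ι₁(q₁ i) + ι₂(q₂ i) parametrizes V(f). (Proposition 2.1, statement 2: if V is a translational surface then it admits a translational parametrization P₁(t₁)+P₂(t₂) in which both curve parametrizations are proper.) -/
noncomputable section

/-- `P : Fin 3 → L` parametrizes the surface `V(f)` if for every polynomial `h`,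
`h(P) = 0` iff `f ∣ h`. -/
def Parametrizes {K : Type*} [Field K] (f : MvPolynomial (Fin 3) K)
    (P : Fin 3 → Lfield K) : Prop :=
  ∀ h : MvPolynomial (Fin 3) K, (MvPolynomial.aeval P) h = 0 ↔ f ∣ h

/-- A curve parametrization is proper if its components generate the full rational
function field over `K`. -/
def IsProper {K : Type*} [Field K] (Q : Fin 3 → RatFunc K) : Prop :=
  IntermediateField.adjoin K (Set.range Q) = ⊤

namespace RatFunc

variable {K : Type*} [Field K]

theorem trdeg_eq_one : Algebra.trdeg K (RatFunc K) = 1 := by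
  have : Algebra.IsAlgebraic (Polynomial K) (RatFunc K) :=
    IsLocalization.isAlgebraic _ (nonZeroDivisors (Polynomial K))
  rw [← trdeg_add_eq K (Polynomial K) (A := RatFunc K), Polynomial.trdeg_of_isDomain,
    trdeg_eq_zero, add_zero]

theorem not_algebraicIndependent_fin_two (x : Fin 2 → RatFunc K) :
    ¬ AlgebraicIndependent K x := fun h => by
  have := h.lift_cardinalMk_le_trdeg
  rw [trdeg_eq_one] at this
  simp at this

theorem algHom_ext {A : Type*} [Field A] [Algebra K A] {φ ψ : RatFunc K →ₐ[K] A}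
    (h : φ X = ψ X) : φ = ψ :=
  IsLocalization.algHom_ext (A := Polynomial K) (nonZeroDivisors (Polynomial K)) <|
    Polynomial.algHom_ext (by simpa [Algebra.algHom] using h)

/-- A tuple of rational functions in one variable, not all of them constant, factors through
an endomorphism of the rational function field as a tuple generating that field. -/
theorem exists_comp_adjoin_range_eq_top {ι : Type*} (p : ι → RatFunc K)
    (hp : ∃ i, ∀ c, p i ≠ C c) :
    ∃ (q : ι → RatFunc K) (σ : RatFunc K →ₐ[K] RatFunc K),
      IntermediateField.adjoin K (Set.range q) = ⊤ ∧ ∀ i, σ (q i) = p i := by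
  set E := IntermediateField.adjoin K (Set.range p) with hE
  have hmem (i) : p i ∈ E := IntermediateField.subset_adjoin _ _ ⟨i, rfl⟩
  have hbot : E ≠ ⊥ := by
    rintro h
    obtain ⟨i, hi⟩ := hp
    obtain ⟨c, hc⟩ := IntermediateField.mem_bot.mp (h ▸ hmem i)
    exact hi c (by simpa using hc.symm)
  let e := Luroth.algEquiv hbot
  let σ : RatFunc K →ₐ[K] RatFunc K := E.val.comp e.toAlgHom
  have hσ (i) : σ (e.symm ⟨p i, hmem i⟩) = p i := by simp [σ]
  refine ⟨fun i => e.symm ⟨p i, hmem i⟩, σ, IntermediateField.map_injective σ ?_, hσ⟩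
  rw [IntermediateField.adjoin_map, ← Set.range_comp]
  have : σ ∘ (fun i => e.symm ⟨p i, hmem i⟩) = p := funext hσ
  rw [this, ← hE]
  ext x
  refine ⟨fun hx => ⟨e.symm ⟨x, hx⟩, trivial, by simp [σ]⟩, ?_⟩
  rintro ⟨y, -, rfl⟩
  exact (e y).2

/-- If an intermediate field contains the image of a nonconstant rational function, then the
image of the variable is algebraic over it. -/
theorem isAlgebraic_apply_X {L : Type*} [Field L] [Algebra K L] (φ : RatFunc K →ₐ[K] L)
    {F : IntermediateField K L} {r : RatFunc K} (hr : Transcendental K r) (hrF : φ r ∈ F) :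
    IsAlgebraic F (φ X) := by
  have hE : F.comap φ ≠ ⊥ := by
    intro h
    have hmem : r ∈ F.comap φ := hrF
    obtain ⟨c, rfl⟩ := IntermediateField.mem_bot.mp (h ▸ hmem)
    exact hr (isAlgebraic_algebraMap c)
  let g : F.comap φ →+* F :=
    ((φ : RatFunc K →+* L).comp (algebraMap (F.comap φ) (RatFunc K))).codRestrict F fun x => x.2
  exact (IntermediateField.isAlgebraic_X hE).ringHom_of_comp_eq g φ g.injective rfl

end RatFunc

namespace MvPolynomial

/-- No irreducible polynomial divides all the relations between three rational functions in
one variable. -/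
theorem not_irreducible_of_aeval_ratFunc {K : Type*} [Field K] {f : MvPolynomial (Fin 3) K}
    (p : Fin 3 → RatFunc K) (h : ∀ g : MvPolynomial (Fin 3) K, aeval p g = 0 → f ∣ g) :
    ¬ Irreducible f := by
  intro hf
  have hdeg (i : Fin 3) : f.degreeOf i = 0 := by
    have := RatFunc.not_algebraicIndependent_fin_two (p ∘ i.succAbove)
    rw [algebraicIndependent_iff] at this
    push Not at this
    obtain ⟨g, hg, hg0⟩ := this
    obtain ⟨k, hk⟩ := h (rename i.succAbove g) (by rwa [aeval_rename])
    have hne : rename i.succAbove g ≠ 0 :=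
      (map_ne_zero_iff _ (rename_injective _ Fin.succAbove_right_injective)).mpr hg0
    have hi : (rename i.succAbove g).degreeOf i = 0 := by
      by_contra hi
      rw [← ne_eq, ← mem_vars_iff_degreeOf_ne_zero] at hi
      obtain ⟨j, -, hj⟩ := mem_vars_rename _ _ hi
      exact Fin.succAbove_ne _ _ hj
    rw [hk] at hne hi
    rw [degreeOf_mul_eq (left_ne_zero_of_mul hne) (right_ne_zero_of_mul hne)] at hi
    omega
  have hvars : f.vars = ∅ :=
    Finset.eq_empty_of_forall_notMem fun i hi => mem_vars_iff_degreeOf_ne_zero.mp hi (hdeg i)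
  rw [vars_eq_empty_iff_eq_C] at hvars
  have hc : f.coeff 0 ≠ 0 := fun hc => hf.ne_zero (by rw [hvars, hc, map_zero])
  exact hf.not_isUnit (hvars ▸ (isUnit_iff_ne_zero.mpr hc).map C)

end MvPolynomial

section

variable {K : Type*} [Field K]

theorem algebraicIndependent_t₁_t₂ : AlgebraicIndependent K ![t₁ K, t₂ K] := by
  have := (MvPolynomial.algebraicIndependent_X (Fin 2) K).map' (f := Algebra.algHom K _ (Lfield K))
    (IsFractionRing.injective (MvPolynomial (Fin 2) K) (Lfield K))
  convert this using 1
  ext i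
  fin_cases i <;> rfl

theorem adjoin_t₁_t₂ : IntermediateField.adjoin K {t₁ K, t₂ K} = ⊤ := by
  rw [eq_top_iff]
  rintro x -
  obtain ⟨a, b, -, rfl⟩ := IsFractionRing.div_surjective (A := MvPolynomial (Fin 2) K) x
  have key (a : MvPolynomial (Fin 2) K) :
      algebraMap _ (Lfield K) a ∈ IntermediateField.adjoin K {t₁ K, t₂ K} := by
    induction a using MvPolynomial.induction_on with
    | C c => exact IntermediateField.algebraMap_mem _ c
    | add p q hp hq => rw [map_add]; exact add_mem hp hq
    | mul_X p i hp =>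
      rw [map_mul]
      refine mul_mem hp (IntermediateField.subset_adjoin _ _ ?_)
      fin_cases i
      · exact .inl rfl
      · exact .inr rfl
  exact div_mem (key a) (key b)

/-- Substituting nonconstant rational functions for the two variables preserves algebraic
independence. -/
theorem algebraicIndependent_ratFunc_apply (ι₁ ι₂ : RatFunc K →ₐ[K] Lfield K)
    (hι₁ : ι₁ RatFunc.X = t₁ K) (hι₂ : ι₂ RatFunc.X = t₂ K) (r₁ r₂ : RatFunc K)
    (h₁ : Transcendental K r₁) (h₂ : Transcendental K r₂) :
    AlgebraicIndependent K ![ι₁ r₁, ι₂ r₂] := by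
  set F := IntermediateField.adjoin K (Set.range ![ι₁ r₁, ι₂ r₂]) with hF
  have hmem (i) : ![ι₁ r₁, ι₂ r₂] i ∈ F := IntermediateField.subset_adjoin _ _ ⟨i, rfl⟩
  have htop : (algebraicClosure F (Lfield K)).restrictScalars K = ⊤ := by
    rw [eq_top_iff, ← adjoin_t₁_t₂, IntermediateField.adjoin_le_iff, ← hι₁, ← hι₂]
    rintro _ (rfl | rfl)
    · exact mem_algebraicClosure_iff.mpr <| RatFunc.isAlgebraic_apply_X ι₁ h₁ (hmem 0)
    · exact mem_algebraicClosure_iff.mpr <| RatFunc.isAlgebraic_apply_X ι₂ h₂ (hmem 1)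
  have halg : Algebra.IsAlgebraic F (Lfield K) :=
    ⟨fun x => mem_algebraicClosure_iff.mp (htop ▸ IntermediateField.mem_top :
      x ∈ (algebraicClosure F (Lfield K)).restrictScalars K)⟩
  rw [hF, IntermediateField.isAlgebraic_adjoin_iff_top] at halg
  refine (Algebra.IsAlgebraic.isTranscendenceBasis_of_lift_le_trdeg_of_finite K _ ?_).1
  simpa using (algebraicIndependent_t₁_t₂ (K := K)).lift_cardinalMk_le_trdeg

/-- Endomorphisms of the two one-variable rational function fields extend to a common
endomorphism of the two-variable rational function field. -/
theorem exists_algHom_apply_comp (ι₁ ι₂ : RatFunc K →ₐ[K] Lfield K)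
    (hι₁ : ι₁ RatFunc.X = t₁ K) (hι₂ : ι₂ RatFunc.X = t₂ K) (σ₁ σ₂ : RatFunc K →ₐ[K] RatFunc K) :
    ∃ σ : Lfield K →ₐ[K] Lfield K, (∀ r, σ (ι₁ r) = ι₁ (σ₁ r)) ∧ ∀ r, σ (ι₂ r) = ι₂ (σ₂ r) := by
  have hind := algebraicIndependent_ratFunc_apply ι₁ ι₂ hι₁ hι₂ (σ₁ .X) (σ₂ .X)
    (mt (isAlgebraic_algHom_iff σ₁ σ₁.injective).mp RatFunc.transcendental_X)
    (mt (isAlgebraic_algHom_iff σ₂ σ₂.injective).mp RatFunc.transcendental_X)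
  let σ : Lfield K →ₐ[K] Lfield K := IsFractionRing.liftAlgHom hind
  have hσ (i) : σ (algebraMap _ _ (MvPolynomial.X i)) = ![ι₁ (σ₁ .X), ι₂ (σ₂ .X)] i :=
    (IsFractionRing.lift_algebraMap hind _).trans (MvPolynomial.aeval_X _ i)
  refine ⟨σ, fun r => ?_, fun r => ?_⟩
  · refine DFunLike.congr_fun (RatFunc.algHom_ext ?_ : (σ.comp ι₁) = ι₁.comp σ₁) r
    simpa [hι₁, t₁] using hσ 0
  · refine DFunLike.congr_fun (RatFunc.algHom_ext ?_ : (σ.comp ι₂) = ι₂.comp σ₂) r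
    simpa [hι₂, t₂] using hσ 1

end

/-- Proposition 2.1, statement 2: if `V(f)` is a translational surface, then it admits
a translational parametrization `P₁(t₁) + P₂(t₂)` with both `P₁` and `P₂` proper. -/
theorem exists_proper_translational_parametrization
    (K : Type*) [Field K] [IsAlgClosed K] [CharZero K]
    (ι₁ ι₂ : RatFunc K →ₐ[K] Lfield K)
    (hι₁ : ι₁ RatFunc.X = t₁ K) (hι₂ : ι₂ RatFunc.X = t₂ K)
    (f : MvPolynomial (Fin 3) K) (hf : Irreducible f)
    (p₁ p₂ : Fin 3 → RatFunc K)
    (hpar : Parametrizes f (fun i => ι₁ (p₁ i) + ι₂ (p₂ i))) :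
    ∃ q₁ q₂ : Fin 3 → RatFunc K,
      IsProper q₁ ∧ IsProper q₂ ∧
      Parametrizes f (fun i => ι₁ (q₁ i) + ι₂ (q₂ i)) := by
  have not_factor (ι : RatFunc K →ₐ[K] Lfield K) (p : Fin 3 → RatFunc K)
      (h : ∀ i, ι₁ (p₁ i) + ι₂ (p₂ i) = ι (p i)) : False := by
    refine MvPolynomial.not_irreducible_of_aeval_ratFunc p (fun g hg => (hpar g).mp ?_) hf
    simp_rw [h]
    rw [← MvPolynomial.comp_aeval_apply, hg, map_zero]
  have hp₁ : ∃ i, ∀ c, p₁ i ≠ RatFunc.C c := by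
    by_contra! h
    choose c hc using h
    refine not_factor ι₂ (fun i => algebraMap K _ (c i) + p₂ i) fun i => ?_
    rw [hc, ← RatFunc.algebraMap_eq_C, map_add, AlgHom.commutes, AlgHom.commutes]
  have hp₂ : ∃ i, ∀ c, p₂ i ≠ RatFunc.C c := by
    by_contra! h
    choose c hc using h
    refine not_factor ι₁ (fun i => p₁ i + algebraMap K _ (c i)) fun i => ?_
    rw [hc, ← RatFunc.algebraMap_eq_C, map_add, AlgHom.commutes, AlgHom.commutes]
  obtain ⟨q₁, σ₁, hq₁, hσ₁⟩ := RatFunc.exists_comp_adjoin_range_eq_top p₁ hp₁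
  obtain ⟨q₂, σ₂, hq₂, hσ₂⟩ := RatFunc.exists_comp_adjoin_range_eq_top p₂ hp₂
  obtain ⟨σ, h₁, h₂⟩ := exists_algHom_apply_comp ι₁ ι₂ hι₁ hι₂ σ₁ σ₂
  refine ⟨q₁, q₂, hq₁, hq₂, fun h => ?_⟩
  rw [← hpar h, ← map_eq_zero_iff σ σ.injective, MvPolynomial.comp_aeval_apply]
  simp only [map_add, h₁, h₂, hσ₁, hσ₂]
end
end

section
/- Let f ∈ MvPolynomial (Fin 3) K be irreducible and non-cylindrical. Then there do not exist p₁ : Fin 3 → RatFunc K and vectors a, b : Fin 3 → K with a ≠ 0 such that the tuple i ↦ ι₁(p₁ i) + (a i) • t₂ + algebraMap K L (b i) parametrizes the surface V(f). (Proposition 2.1, statement 4: in a translational parametrization P₁(t₁)+P₂(t₂) of a non-cylindrical surface, the curve C₂ cannot be a line t ↦ a·t + b; by symmetry the same holds for C₁.) -/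
noncomputable section

/-- `f` is non-cylindrical if no nonzero constant directional derivative of `f` vanishes. -/
def NonCylindrical {K : Type*} [Field K] (f : MvPolynomial (Fin 3) K) : Prop :=
  ∀ a : Fin 3 → K, a ≠ 0 → (∑ i, a i • MvPolynomial.pderiv i f) ≠ 0

namespace MvPolynomial

/-- The chain rule for a derivation applied to the value of a polynomial. -/
theorem derivation_aeval {σ R A : Type*} [Fintype σ] [CommRing R] [CommRing A] [Algebra R A]
    (D : Derivation R A A) (P : σ → A) (f : MvPolynomial σ R) :
    D (aeval P f) = ∑ i, aeval P (pderiv i f) * D (P i) := by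
  classical
  induction f using MvPolynomial.induction_on with
  | C c => simp
  | add p q hp hq => simp [hp, hq, add_mul, Finset.sum_add_distrib]
  | mul_X p j hp =>
    simp only [map_mul, aeval_X, Derivation.leibniz, hp, smul_eq_mul, map_add, pderiv_X, add_mul,
      Finset.sum_add_distrib, Finset.mul_sum, Pi.single_apply, mul_ite, ite_mul, apply_ite (aeval P),
      map_zero, mul_one, mul_zero, zero_mul, Finset.sum_ite_eq, Finset.mem_univ, if_true,
      mul_assoc]

/-- A constant directional derivative of `f` divisible by `f` vanishes. -/
theorem sum_smul_pderiv_eq_zero_of_dvd {σ R : Type*} [Fintype σ] [CommRing R] [IsDomain R]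
    (a : σ → R) (f : MvPolynomial σ R) (h : f ∣ ∑ i, a i • pderiv i f) :
    ∑ i, a i • pderiv i f = 0 := by
  by_contra hne
  obtain ⟨m, hm, hdeg⟩ := Finset.exists_mem_eq_sup _ (support_nonempty.2 hne)
    (fun m => m.sum fun _ => id)
  rw [mem_support_iff, coeff_sum] at hm
  obtain ⟨i, -, hi⟩ := Finset.exists_ne_zero_of_sum_ne_zero hm
  rw [coeff_smul, coeff_pderiv, smul_eq_mul] at hi
  have hmem : m + Finsupp.single i 1 ∈ f.support :=
    mem_support_iff.2 (left_ne_zero_of_mul (right_ne_zero_of_mul hi))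
  have hle := le_totalDegree hmem
  rw [Finsupp.sum_add_index' (by simp) (by simp), Finsupp.sum_single_index rfl] at hle
  have hdvd := totalDegree_le_of_dvd_of_isDomain h hne
  have hdeg' : (∑ i, a i • pderiv i f).totalDegree = m.sum fun _ => id := hdeg
  simp only [Function.id_def] at hle hdeg'
  omega

end MvPolynomial

/-- A derivation into a `T`-module extends along a formally étale algebra `T`. -/
theorem Derivation.exists_extension_of_formallyEtale {R S T : Type*} [CommRing R] [CommRing S]
    [CommRing T] [Algebra R S] [Algebra R T] [Algebra S T] [IsScalarTower R S T]
    [Algebra.FormallyEtale S T] (d : Derivation R S T) :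
    ∃ D : Derivation R T T, ∀ s, D (algebraMap S T s) = d s := by
  refine ⟨((d.liftKaehlerDifferential.liftBaseChange T).comp
    (KaehlerDifferential.tensorKaehlerEquivOfFormallyEtale R S T).symm.toLinearMap).compDer
      (KaehlerDifferential.D R T), fun s => ?_⟩
  simp [KaehlerDifferential.tensorKaehlerEquivOfFormallyEtale_symm_D_algebraMap]

/-- A derivation along a homomorphism out of `RatFunc K` vanishes on its range as soon as it
vanishes on the image of the variable. -/
theorem RatFunc.derivation_map_eq_zero {K L : Type*} [Field K] [Field L] [Algebra K L]
    (D : Derivation K L L) (ι : RatFunc K →ₐ[K] L) (h : D (ι RatFunc.X) = 0) (p : RatFunc K) :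
    D (ι p) = 0 := by
  have hpoly (q : Polynomial K) : D (ι (algebraMap _ _ q)) = 0 := by
    have : ι (algebraMap _ _ q) = Polynomial.aeval (ι RatFunc.X) q := by
      rw [Polynomial.aeval_algHom_apply, ← RatFunc.algebraMap_X, Polynomial.aeval_algebraMap_apply,
        Polynomial.aeval_X_left_apply]
    rw [this, Derivation.map_aeval, h, smul_zero]
  rw [← RatFunc.num_div_denom p, map_div₀, Derivation.leibniz_div, hpoly, hpoly]
  simp

/-- The partial derivative of `K(t₁,t₂)` with respect to `t₂`. -/
theorem exists_derivation_t₂ (K : Type*) [Field K] :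
    ∃ D : Derivation K (Lfield K) (Lfield K), D (t₁ K) = 0 ∧ D (t₂ K) = 1 := by
  have := Algebra.FormallyEtale.of_isLocalization (Rₘ := Lfield K)
    (nonZeroDivisors (MvPolynomial (Fin 2) K))
  obtain ⟨D, hD⟩ := Derivation.exists_extension_of_formallyEtale
    (MvPolynomial.mkDerivation K (![0, 1] : Fin 2 → Lfield K))
  exact ⟨D, by simp [t₁, hD], by simp [t₂, hD]⟩

/-- Proposition 2.1, statement 4: in a translational parametrization `P₁(t₁) + P₂(t₂)`
of a non-cylindrical surface, the second curve cannot be a line `t ↦ a·t + b`. -/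
theorem second_factor_not_a_line (K : Type*) [Field K] [IsAlgClosed K] [CharZero K]
    (ι₁ ι₂ : RatFunc K →ₐ[K] Lfield K)
    (hι₁ : ι₁ RatFunc.X = t₁ K) (hι₂ : ι₂ RatFunc.X = t₂ K)
    (f : MvPolynomial (Fin 3) K) (hf : Irreducible f) (hnc : NonCylindrical f) :
    ¬ ∃ (p₁ : Fin 3 → RatFunc K) (a b : Fin 3 → K), a ≠ 0 ∧
      Parametrizes f
        (fun i => ι₁ (p₁ i) + a i • t₂ K + algebraMap K (Lfield K) (b i)) := by
  rintro ⟨p₁, a, b, ha, hP⟩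
  obtain ⟨D, hD₁, hD₂⟩ := exists_derivation_t₂ K
  set P : Fin 3 → Lfield K :=
    fun i => ι₁ (p₁ i) + a i • t₂ K + algebraMap K (Lfield K) (b i) with hPdef
  have hDP (i : Fin 3) : D (P i) = algebraMap K (Lfield K) (a i) := by
    simp only [hPdef, map_add, Derivation.map_smul, Derivation.map_algebraMap, hD₂, add_zero,
      RatFunc.derivation_map_eq_zero D ι₁ (by rw [hι₁, hD₁]), zero_add]
    rw [Algebra.smul_def, mul_one]
  have hchain := MvPolynomial.derivation_aeval D P f
  rw [(hP f).2 dvd_rfl, map_zero] at hchain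
  refine hnc a ha (MvPolynomial.sum_smul_pderiv_eq_zero_of_dvd a f ((hP _).1 ?_))
  rw [map_sum, hchain]
  refine Finset.sum_congr rfl fun i _ => ?_
  rw [map_smul, hDP, Algebra.smul_def, mul_comm]
end
end

section
/- Let f ∈ MvPolynomial (Fin 3) K be irreducible and non-cylindrical, and suppose there exist p₁, p₂ : Fin 3 → RatFunc K such that the tuple i ↦ ι₁(p₁ i) + ι₂(p₂ i) parametrizes the surface V(f) (V is a translational surface). Then there exist q₁ : Fin 3 → RatFunc K and u, v : Fin 3 → Polynomial K such that: for every i, v i ≠ 0, (v i).eval 0 ≠ 0 and (u i).eval 0 = 0 (so the tuple P₂ with components (u i : RatFunc K)/(v i) satisfies P₂(0) = (0,0,0)); for some i, (Polynomial.derivative (u i) * v i − u i * Polynomial.derivative (v i)).eval 0 ≠ 0 (so the derivative vector P₂′(0) is nonzero); the tuple i ↦ (u i : RatFunc K)/(v i) is proper; and the tuple i ↦ ι₁(q₁ i) + ι₂((u i : RatFunc K)/(v i)) parametrizes V(f). (Lemma 2.2: a translational surface admits a translational parametrization whose second factor is proper and satisfies P₂(0) = (0,0,0) and P₂′(0) ≠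 (0,0,0).) -/
noncomputable section

/-- Two `K`-algebra homomorphisms from `K(X)` to a field agree if they agree on `X`. -/
theorem RatFunc.algHom_eq_of_X {K A : Type*} [Field K] [Field A] [Algebra K A]
    {φ ψ : RatFunc K →ₐ[K] A} (h : φ RatFunc.X = ψ RatFunc.X) : φ = ψ := by
  have key (χ : RatFunc K →ₐ[K] A) (p : Polynomial K) :
      χ (algebraMap (Polynomial K) (RatFunc K) p) = Polynomial.aeval (χ RatFunc.X) p := by
    rw [← RatFunc.aeval_X_left_eq_algebraMap, Polynomial.aeval_algHom_apply]
  ext x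
  rw [← RatFunc.num_div_denom x, map_div₀, map_div₀, key, key, key, key, h]

/-- Evaluation of `K(X)` at a transcendental element of a field. -/
theorem RatFunc.exists_algHom_of_transcendental {K A : Type*} [Field K] [Field A] [Algebra K A]
    {g : A} (hg : Transcendental K g) : ∃ σ : RatFunc K →ₐ[K] A, σ RatFunc.X = g :=
  ⟨(IntermediateField.val _).comp (RatFunc.algEquivOfTranscendental g hg).toAlgHom, by simp⟩

/-- The image of `K(X)` under a `K`-algebra homomorphism is generated by the image of `X`. -/
theorem RatFunc.map_top_eq_adjoin {K A : Type*} [Field K] [Field A] [Algebra K A]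
    (σ : RatFunc K →ₐ[K] A) :
    (⊤ : IntermediateField K (RatFunc K)).map σ =
      IntermediateField.adjoin K {σ RatFunc.X} := by
  rw [← RatFunc.adjoin_X, IntermediateField.adjoin_map, Set.image_singleton]

theorem IsProper.of_map {K : Type*} [Field K] {σ : RatFunc K →ₐ[K] RatFunc K}
    {r : Fin 3 → RatFunc K}
    (h : IntermediateField.adjoin K (Set.range fun i => σ (r i)) =
      IntermediateField.adjoin K {σ RatFunc.X}) : IsProper r := by
  refine IntermediateField.map_injective σ ?_
  rw [RatFunc.map_top_eq_adjoin, IntermediateField.adjoin_map, ← h, ← Set.range_comp]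
  rfl

theorem IsProper.map {K : Type*} [Field K] {σ : RatFunc K →ₐ[K] RatFunc K}
    {r : Fin 3 → RatFunc K} (h : IsProper r)
    (hσ : IntermediateField.adjoin K {σ RatFunc.X} = ⊤) : IsProper fun i => σ (r i) := by
  have := congrArg (IntermediateField.map σ) h
  rw [RatFunc.map_top_eq_adjoin, hσ, IntermediateField.adjoin_map, ← Set.range_comp] at this
  exact this

theorem IsProper.sub_C {K : Type*} [Field K] {r : Fin 3 → RatFunc K} (h : IsProper r)
    (c : Fin 3 → K) : IsProper fun i => r i - RatFunc.C (c i) := by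
  rw [IsProper, eq_top_iff, ← h, IntermediateField.adjoin_le_iff]
  rintro _ ⟨i, rfl⟩
  have := add_mem
    (IntermediateField.subset_adjoin K (Set.range fun i => r i - RatFunc.C (c i)) ⟨i, rfl⟩)
    (IntermediateField.algebraMap_mem _ (c i))
  simpa [RatFunc.algebraMap_eq_C] using this

/-- An endomorphism of `K(X)`, applied to the second variable only, extends to `K(t₁,t₂)`. -/
theorem exists_algHom_subst_second {K : Type*} [Field K]
    (ι₁ ι₂ : RatFunc K →ₐ[K] Lfield K)
    (hι₁ : ι₁ RatFunc.X = t₁ K) (hι₂ : ι₂ RatFunc.X = t₂ K)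
    (σ : RatFunc K →ₐ[K] RatFunc K) :
    ∃ Θ : Lfield K →ₐ[K] Lfield K, (∀ x, Θ (ι₁ x) = ι₁ x) ∧ ∀ x, Θ (ι₂ x) = ι₂ (σ x) := by
  have hind : AlgebraicIndependent K
      (fun i : Fin 2 => algebraMap (MvPolynomial (Fin 2) K) (Lfield K) (MvPolynomial.X i)) :=
    (MvPolynomial.algebraicIndependent_X (Fin 2) K).map'
      (f := IsScalarTower.toAlgHom K (MvPolynomial (Fin 2) K) (Lfield K))
      (IsFractionRing.injective _ _)
  have h1 : Transcendental (IntermediateField.adjoin K {t₂ K}) (t₁ K) := by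
    rw [IntermediateField.transcendental_adjoin_iff]
    have := hind.transcendental_adjoin (s := {1}) (i := 0) (by simp)
    rw [Set.image_singleton] at this
    exact this
  have h2 : Transcendental K (ι₂ (σ RatFunc.X)) := by
    rw [← AlgHom.comp_apply]
    exact fun halg => RatFunc.transcendental_X
      ((isAlgebraic_algHom_iff _ (ι₂.comp σ).toRingHom.injective).1 halg)
  have hmem (x : RatFunc K) : ι₂ x ∈ IntermediateField.adjoin K {t₂ K} := by
    rw [← hι₂, ← RatFunc.map_top_eq_adjoin]
    exact ⟨x, trivial, rfl⟩
  have hsum : AlgebraicIndependent K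
      (Sum.elim (fun _ : Unit => t₁ K) fun _ : Unit => ι₂ (σ RatFunc.X)) := by
    refine AlgebraicIndependent.sumElim_of_tower
      (S := IntermediateField.adjoin K {t₂ K}) ?_ ?_ ?_
    · exact (algebraicIndependent_unique_type_iff).2 h2
    · rintro _ ⟨_, rfl⟩
      exact ⟨⟨_, hmem _⟩, rfl⟩
    · exact (algebraicIndependent_unique_type_iff).2 h1
  have hfin : AlgebraicIndependent K ![t₁ K, ι₂ (σ RatFunc.X)] := by
    have := hsum.comp ![Sum.inl (), Sum.inr ()] (by
      intro i j; fin_cases i <;> fin_cases j <;> simp)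
    convert this using 1
    ext i; fin_cases i <;> rfl
  let Θ : Lfield K →ₐ[K] Lfield K := IsFractionRing.liftAlgHom (K := Lfield K) hfin
  have hΘ (i : Fin 2) : Θ (algebraMap (MvPolynomial (Fin 2) K) (Lfield K) (MvPolynomial.X i)) =
      ![t₁ K, ι₂ (σ RatFunc.X)] i := by
    exact (IsFractionRing.lift_algebraMap hfin _).trans (MvPolynomial.aeval_X _ i)
  refine ⟨Θ, fun x => ?_, fun x => ?_⟩
  · refine DFunLike.congr_fun (RatFunc.algHom_eq_of_X (φ := Θ.comp ι₁) (ψ := ι₁) ?_) x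
    rw [AlgHom.comp_apply, hι₁]
    exact hΘ 0
  · refine DFunLike.congr_fun (RatFunc.algHom_eq_of_X (φ := Θ.comp ι₂) (ψ := ι₂.comp σ) ?_) x
    rw [AlgHom.comp_apply, hι₂]
    exact hΘ 1

/-- Parametrizations may be pulled back along injective homomorphisms. -/
theorem parametrizes_map_iff {K : Type*} [Field K] {f : MvPolynomial (Fin 3) K}
    {P : Fin 3 → Lfield K} (Θ : Lfield K →ₐ[K] Lfield K) :
    Parametrizes f (fun i => Θ (P i)) ↔ Parametrizes f P := by
  refine forall_congr' fun h => ?_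
  have : (MvPolynomial.aeval fun i => Θ (P i)) h = Θ (MvPolynomial.aeval P h) :=
    (MvPolynomial.comp_aeval_apply _ Θ h).symm
  rw [this, map_eq_zero]

/-- Any two rational functions in one variable satisfy an algebraic relation. -/
theorem RatFunc.not_algebraicIndependent_fin_two_s3 {K : Type*} [Field K] (q : Fin 2 → RatFunc K) :
    ¬ AlgebraicIndependent K q := by
  intro h
  have halg : Algebra.IsAlgebraic (Algebra.adjoin K {(RatFunc.X : RatFunc K)}) (RatFunc K) := by
    rw [← IntermediateField.isAlgebraic_adjoin_iff_top, RatFunc.adjoin_X]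
    exact ⟨fun x => isAlgebraic_algebraMap (⟨x, trivial⟩ : (⊤ : IntermediateField K (RatFunc K)))⟩
  have h1 := Algebra.IsAlgebraic.trdeg_le_cardinalMk K {(RatFunc.X : RatFunc K)}
  have h2 := h.lift_cardinalMk_le_trdeg
  simp only [Cardinal.mk_fintype, Fintype.card_fin, Cardinal.lift_natCast] at h2
  rw [Cardinal.mk_singleton] at h1
  have h3 := h2.trans (Cardinal.lift_le.2 h1)
  simp at h3

/-- A hypersurface parametrized by rational functions of a single variable is cylindrical. -/
theorem NonCylindrical.not_parametrizes_of_algHom {K : Type*} [Field K]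
    {f : MvPolynomial (Fin 3) K} (hnc : NonCylindrical f) (ι : RatFunc K →ₐ[K] Lfield K)
    (q : Fin 3 → RatFunc K) : ¬ Parametrizes f (fun i => ι (q i)) := by
  intro hpar
  have hdep := RatFunc.not_algebraicIndependent_fin_two_s3 ![q 0, q 1]
  rw [algebraicIndependent_iff] at hdep
  push Not at hdep
  obtain ⟨g, hg, hg0⟩ := hdep
  let e : Fin 2 → Fin 3 := Fin.castSucc
  have hgr : MvPolynomial.rename e g ≠ 0 := by
    rwa [Ne, map_eq_zero_iff _ (MvPolynomial.rename_injective _ (Fin.castSucc_injective 2))]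
  have hdvd : f ∣ MvPolynomial.rename e g := by
    refine (hpar _).1 ?_
    rw [MvPolynomial.aeval_rename]
    have hcomp : (fun i => ι (q i)) ∘ e = fun i => ι (![q 0, q 1] i) := by
      ext i; fin_cases i <;> rfl
    rw [hcomp, ← MvPolynomial.comp_aeval_apply, hg, map_zero]
  obtain ⟨k, hk⟩ := hdvd
  have hf0 : f ≠ 0 := by rintro rfl; simp [hk] at hgr
  have hk0 : k ≠ 0 := by rintro rfl; simp [hk] at hgr
  have hvars : (2 : Fin 3) ∉ (MvPolynomial.rename e g).vars := by
    classical
    intro hmem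
    obtain ⟨j, -, hj⟩ := Finset.mem_image.1 (MvPolynomial.vars_rename e g hmem)
    fin_cases j <;> simp [e] at hj
  rw [MvPolynomial.mem_vars_iff_degreeOf_ne_zero, not_not, hk,
    MvPolynomial.degreeOf_mul_eq hf0 hk0] at hvars
  have hpd : MvPolynomial.pderiv 2 f = 0 :=
    MvPolynomial.pderiv_eq_zero_of_notMem_vars fun hmem =>
      MvPolynomial.mem_vars_iff_degreeOf_ne_zero.1 hmem (by omega)
  refine hnc (Pi.single 2 1) (by simp) ?_
  simp [Pi.single_apply, hpd]

/-- In characteristic zero, a proper parametrization has a component whose derivative has nonzero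
numerator. -/
theorem IsProper.exists_wronskian_ne_zero {K : Type*} [Field K] [CharZero K]
    {r : Fin 3 → RatFunc K} (h : IsProper r) :
    ∃ i, Polynomial.derivative (r i).num * (r i).denom -
      (r i).num * Polynomial.derivative (r i).denom ≠ 0 := by
  by_contra! hzero
  have hconst (i : Fin 3) : ∃ c, r i = RatFunc.C c := by
    have hz := sub_eq_zero.1 (hzero i)
    have hdvd : (r i).denom ∣ Polynomial.derivative (r i).denom :=
      (RatFunc.isCoprime_num_denom (r i)).symm.dvd_of_dvd_mul_left
        (hz ▸ dvd_mul_left _ _)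
    have hd : Polynomial.derivative (r i).denom = 0 := by
      by_contra hne
      exact absurd (Polynomial.degree_le_of_dvd hdvd hne)
        (not_le.2 (Polynomial.degree_derivative_lt (r i).denom_ne_zero))
    have hn : Polynomial.derivative (r i).num = 0 := by
      rw [hd, mul_zero] at hz
      exact (mul_eq_zero.1 hz).resolve_right (r i).denom_ne_zero
    exact (RatFunc.eq_C_iff _).2 ⟨Polynomial.derivative_eq_zero.1 hn,
      Polynomial.derivative_eq_zero.1 hd⟩
  have hbot : IntermediateField.adjoin K (Set.range r) ≤ ⊥ := by
    rw [IntermediateField.adjoin_le_iff]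
    rintro _ ⟨i, rfl⟩
    obtain ⟨c, hc⟩ := hconst i
    rw [hc]
    exact IntermediateField.algebraMap_mem _ c
  rw [h] at hbot
  obtain ⟨c, hc⟩ := IntermediateField.mem_bot.1 (hbot (x := (RatFunc.X : RatFunc K)) trivial)
  exact RatFunc.transcendental_X (hc ▸ isAlgebraic_algebraMap c)

/-- A proper parametrization can be translated in its parameter and in space so that it passes
through the origin at `0` with nonzero derivative. -/
theorem IsProper.exists_shift {K : Type*} [Field K] [CharZero K]
    {r : Fin 3 → RatFunc K} (h : IsProper r) :
    ∃ (s : K) (c : Fin 3 → K) (u v : Fin 3 → Polynomial K),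
      (∀ i, (v i).eval 0 ≠ 0) ∧ (∀ i, (u i).eval 0 = 0) ∧
      (∃ i, (Polynomial.derivative (u i) * v i -
        u i * Polynomial.derivative (v i)).eval 0 ≠ 0) ∧
      ∀ τ : RatFunc K →ₐ[K] RatFunc K, τ RatFunc.X = RatFunc.X + RatFunc.C s →
        ∀ i, (u i : RatFunc K) / (v i : RatFunc K) = τ (r i) - RatFunc.C (c i) := by
  obtain ⟨i₀, hi₀⟩ := h.exists_wronskian_ne_zero
  obtain ⟨s, hs⟩ := Polynomial.exists_eval_ne_zero_of_natDegree_lt_card _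
    (mul_ne_zero hi₀ (Finset.prod_ne_zero_iff.2 fun i (_ : i ∈ Finset.univ) =>
      (r i).denom_ne_zero)) (Cardinal.natCast_lt_aleph0.trans_le (Cardinal.aleph0_le_mk K))
  rw [Polynomial.eval_mul, Polynomial.eval_prod, mul_ne_zero_iff, Finset.prod_ne_zero_iff] at hs
  obtain ⟨hs₀, hs⟩ := hs
  replace hs (i) : (r i).denom.eval s ≠ 0 := hs i (Finset.mem_univ i)
  let c (i : Fin 3) : K := (r i).num.eval s / (r i).denom.eval s
  let v (i : Fin 3) : Polynomial K := (r i).denom.comp (Polynomial.X + Polynomial.C s)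
  let u (i : Fin 3) : Polynomial K :=
    (r i).num.comp (Polynomial.X + Polynomial.C s) - Polynomial.C (c i) * v i
  have hv (i) : (v i).eval 0 ≠ 0 := by simpa [v] using hs i
  refine ⟨s, c, u, v, hv, fun i => ?_, ⟨i₀, ?_⟩, fun τ hτ i => ?_⟩
  · simp [u, v, c, div_mul_cancel₀ _ (hs i)]
  · convert hs₀ using 1
    simp only [u, v, Polynomial.derivative_sub, Polynomial.derivative_C_mul,
      Polynomial.derivative_comp, Polynomial.derivative_add, Polynomial.derivative_X,
      Polynomial.derivative_C, Polynomial.eval_sub, Polynomial.eval_mul, Polynomial.eval_comp,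
      Polynomial.eval_add, Polynomial.eval_X, Polynomial.eval_C, Polynomial.eval_one,
      Polynomial.eval_zero, zero_add]
    ring
  · have hτp (p : Polynomial K) : τ (algebraMap (Polynomial K) (RatFunc K) p) =
        algebraMap (Polynomial K) (RatFunc K) (p.comp (Polynomial.X + Polynomial.C s)) := by
      rw [← RatFunc.aeval_X_left_eq_algebraMap, ← Polynomial.aeval_algHom_apply, hτ,
        ← RatFunc.aeval_X_left_eq_algebraMap, Polynomial.aeval_comp]
      simp
    have hv0 : algebraMap (Polynomial K) (RatFunc K) (v i) ≠ 0 :=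
      RatFunc.algebraMap_ne_zero fun h0 => hv i (by simp [h0])
    conv_rhs => rw [← RatFunc.num_div_denom (r i), map_div₀, hτp, hτp]
    rw [RatFunc.coePolynomial_eq_algebraMap, RatFunc.coePolynomial_eq_algebraMap,
      ← RatFunc.algebraMap_C, eq_sub_iff_add_eq, div_add' _ _ _ hv0]
    simp [u, v]

/-- Lemma 2.2: a translational surface admits a translational parametrization whose second
factor `P₂` is proper and satisfies `P₂(0) = (0,0,0)` and `P₂′(0) ≠ (0,0,0)`. -/
theorem exists_normalized_second_factor
    (K : Type*) [Field K] [IsAlgClosed K] [CharZero K]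
    (ι₁ ι₂ : RatFunc K →ₐ[K] Lfield K)
    (hι₁ : ι₁ RatFunc.X = t₁ K) (hι₂ : ι₂ RatFunc.X = t₂ K)
    (f : MvPolynomial (Fin 3) K) (hf : Irreducible f) (hnc : NonCylindrical f)
    (p₁ p₂ : Fin 3 → RatFunc K)
    (hpar : Parametrizes f (fun i => ι₁ (p₁ i) + ι₂ (p₂ i))) :
    ∃ (q₁ : Fin 3 → RatFunc K) (u v : Fin 3 → Polynomial K),
      (∀ i, v i ≠ 0) ∧
      (∀ i, (v i).eval 0 ≠ 0) ∧
      (∀ i, (u i).eval 0 = 0) ∧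
      (∃ i, (Polynomial.derivative (u i) * v i - u i * Polynomial.derivative (v i)).eval 0 ≠ 0) ∧
      IsProper (fun i => (u i : RatFunc K) / (v i : RatFunc K)) ∧
      Parametrizes f (fun i => ι₁ (q₁ i) + ι₂ ((u i : RatFunc K) / (v i : RatFunc K))) := by
  set E := IntermediateField.adjoin K (Set.range p₂) with hE
  have hEbot : E ≠ ⊥ := by
    intro hbot
    have hconst (i : Fin 3) : ∃ c, algebraMap K (RatFunc K) c = p₂ i := by
      have hmem : p₂ i ∈ E := IntermediateField.subset_adjoin K _ ⟨i, rfl⟩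
      rw [hbot] at hmem
      exact IntermediateField.mem_bot.1 hmem
    choose c hc using hconst
    refine hnc.not_parametrizes_of_algHom ι₁ (fun i => p₁ i + algebraMap K (RatFunc K) (c i)) ?_
    simpa only [map_add, AlgHom.commutes, ← hc] using hpar
  obtain ⟨σ, hσ⟩ := RatFunc.exists_algHom_of_transcendental
    (RatFunc.Luroth.transcendental_generator hEbot)
  have hEσ : E = IntermediateField.adjoin K {σ RatFunc.X} := by
    rw [hσ]; exact RatFunc.Luroth.eq_adjoin_generator
  have hr (i : Fin 3) : ∃ x, σ x = p₂ i := by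
    have hmem : p₂ i ∈ E := IntermediateField.subset_adjoin K _ ⟨i, rfl⟩
    rw [hEσ, ← RatFunc.map_top_eq_adjoin] at hmem
    obtain ⟨x, -, hx⟩ := hmem
    exact ⟨x, hx⟩
  choose r hr using hr
  have hproper : IsProper r := IsProper.of_map (σ := σ) (by simpa only [hr] using hEσ)
  obtain ⟨s, c, u, v, hv, hu, hw, huv⟩ := hproper.exists_shift
  have hadj : IntermediateField.adjoin K {(RatFunc.X + RatFunc.C s : RatFunc K)} = ⊤ := by
    rw [eq_top_iff, ← RatFunc.adjoin_X, IntermediateField.adjoin_simple_le_iff]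
    have := sub_mem (IntermediateField.mem_adjoin_simple_self K (RatFunc.X + RatFunc.C s))
      (IntermediateField.algebraMap_mem _ s)
    simpa [RatFunc.algebraMap_eq_C] using this
  have htr : Transcendental K (RatFunc.X + RatFunc.C s : RatFunc K) := fun halg =>
    RatFunc.transcendental_X (K := K) (by
      simpa [RatFunc.algebraMap_eq_C] using halg.sub (isAlgebraic_algebraMap s))
  obtain ⟨τ, hτ⟩ := RatFunc.exists_algHom_of_transcendental htr
  have huv' := huv τ hτ
  have hpar_r : Parametrizes f (fun i => ι₁ (p₁ i) + ι₂ (r i)) := by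
    obtain ⟨Θ, hΘ₁, hΘ₂⟩ := exists_algHom_subst_second ι₁ ι₂ hι₁ hι₂ σ
    rw [← parametrizes_map_iff Θ]
    simpa only [map_add, hΘ₁, hΘ₂, hr] using hpar
  refine ⟨fun i => p₁ i + RatFunc.C (c i), u, v, fun i h0 => hv i (by simp [h0]), hv, hu, hw,
    ?_, ?_⟩
  · simp only [huv']
    exact (hproper.map (hτ ▸ hadj)).sub_C c
  · obtain ⟨Θ, hΘ₁, hΘ₂⟩ := exists_algHom_subst_second ι₁ ι₂ hι₁ hι₂ τ
    rw [← parametrizes_map_iff Θ] at hpar_r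
    simpa only [huv', map_add, map_sub, hΘ₁, hΘ₂, ← RatFunc.algebraMap_eq_C, AlgHom.commutes,
      add_add_sub_cancel] using hpar_r
end
end

section
/- Let f ∈ MvPolynomial (Fin 3) K be irreducible and non-cylindrical. Let q₁ : Fin 3 → RatFunc K and u, v : Fin 3 → Polynomial K satisfy, for every i, v i ≠ 0, (v i).eval 0 ≠ 0 and (u i).eval 0 = 0 (so P₂(0) = (0,0,0)). Set a i := ((Polynomial.derivative (u i) * v i − u i * Polynomial.derivative (v i)).eval 0)/(((v i).eval 0)²) (the derivative vector P₂′(0)) and assume a ≠ 0. Assume the tuple P with P i = ι₁(q₁ i) + ι₂((u i : RatFunc K)/(v i)) parametrizes the surface V(f). Set g := ∑ i, a i • (MvPolynomial.pderiv i f). Then: (MvPolynomial.aeval q₁) f = 0 and (MvPolynomial.aeval q₁) g = 0 in RatFunc K (the curve P₁ lies on the space curve f = g = 0); g is not constant, i.e. 0 < g.totalDegree; and ¬ f ∣ g (f and g are linearly independent, so the equations f = g = 0 define a space curve). (Theorem 3.1.) -/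
noncomputable section

theorem PowerSeries.aeval_X_eq_coe_map {K F : Type*} [Field K] [Field F] [Algebra K F]
    (p : Polynomial K) :
    Polynomial.aeval (PowerSeries.X : PowerSeries F) p
      = ((p.map (algebraMap K F) : Polynomial F) : PowerSeries F) := by
  induction p using Polynomial.induction_on' with
  | add p q hp hq => simp [hp, hq]
  | monomial n a =>
    simp [← Polynomial.C_mul_X_pow_eq_monomial, PowerSeries.algebraMap_apply]

theorem PowerSeries.coeff_polynomial_aeval_X {K F : Type*} [Field K] [Field F] [Algebra K F]
    (p : Polynomial K) (n : ℕ) :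
    PowerSeries.coeff n (Polynomial.aeval (PowerSeries.X : PowerSeries F) p)
      = algebraMap K F (p.coeff n) := by
  rw [PowerSeries.aeval_X_eq_coe_map, Polynomial.coeff_coe, Polynomial.coeff_map]

theorem PowerSeries.constantCoeff_polynomial_aeval_X {K F : Type*} [Field K] [Field F]
    [Algebra K F] (p : Polynomial K) :
    PowerSeries.constantCoeff (Polynomial.aeval (PowerSeries.X : PowerSeries F) p)
      = algebraMap K F (p.eval 0) := by
  rw [← PowerSeries.coeff_zero_eq_constantCoeff_apply, PowerSeries.coeff_polynomial_aeval_X,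
    Polynomial.coeff_zero_eq_eval_zero]

theorem PowerSeries.constantCoeff_mvPolynomial_aeval {K F σ : Type*} [Field K] [Field F]
    [Algebra K F] (p : σ → PowerSeries F) (f : MvPolynomial σ K) :
    PowerSeries.constantCoeff (MvPolynomial.aeval p f) =
      MvPolynomial.aeval (fun j => PowerSeries.constantCoeff (p j)) f := by
  induction f using MvPolynomial.induction_on with
  | C a => simp [PowerSeries.algebraMap_apply]
  | add p q hp hq => simp [hp, hq]
  | mul_X p i hp => simp [hp]

/-- The chain rule for substituting power series into a polynomial, at the origin. -/
theorem PowerSeries.coeff_one_mvPolynomial_aeval {K F σ : Type*} [Fintype σ] [Field K] [Field F]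
    [Algebra K F] (p : σ → PowerSeries F) (f : MvPolynomial σ K) :
    PowerSeries.coeff 1 (MvPolynomial.aeval p f) =
      ∑ i, PowerSeries.coeff 1 (p i) *
        MvPolynomial.aeval (fun j => PowerSeries.constantCoeff (p j))
          (MvPolynomial.pderiv i f) := by
  classical
  induction f using MvPolynomial.induction_on with
  | C a => simp [PowerSeries.algebraMap_apply]
  | add p q hp hq => simp [hp, hq, mul_add, Finset.sum_add_distrib]
  | mul_X g i hg =>
    rw [map_mul, PowerSeries.coeff_one_mul, hg, PowerSeries.constantCoeff_mvPolynomial_aeval]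
    have hi (j : σ) : MvPolynomial.aeval (fun j => PowerSeries.constantCoeff (p j))
        (MvPolynomial.pderiv j (MvPolynomial.X i : MvPolynomial σ K)) =
          if j = i then 1 else 0 := by
      rw [MvPolynomial.pderiv_X]
      split_ifs with h
      · simp [h]
      · simp [Pi.single_eq_of_ne' h]
    simp only [MvPolynomial.pderiv_mul, map_add, map_mul, MvPolynomial.aeval_X, hi, mul_add,
      Finset.sum_add_distrib, Finset.sum_mul, mul_ite, mul_one, mul_zero, Finset.sum_ite_eq',
      Finset.mem_univ, if_true]
    congr 1
    · exact Finset.sum_congr rfl fun j _ => by ring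
    · rw [PowerSeries.constantCoeff_mvPolynomial_aeval, mul_comm]

theorem MvPolynomial.totalDegree_pderiv_lt {R σ : Type*} [CommSemiring R] (f : MvPolynomial σ R)
    (i : σ) (h : 0 < f.totalDegree) :
    (MvPolynomial.pderiv i f).totalDegree < f.totalDegree := by
  rw [MvPolynomial.totalDegree, Finset.sup_lt_iff h]
  intro m hm
  rw [MvPolynomial.mem_support_iff, MvPolynomial.coeff_pderiv] at hm
  have hf := MvPolynomial.le_totalDegree
    (MvPolynomial.mem_support_iff.mpr (left_ne_zero_of_mul hm))
  rw [Finsupp.sum_add_index' (fun _ => rfl) (fun _ _ _ => rfl),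
    Finsupp.sum_single_index rfl] at hf
  exact hf

theorem algebraicIndependent_ratFunc_X_powerSeries_X (K : Type*) [Field K] :
    AlgebraicIndependent K
      ![PowerSeries.C (RatFunc.X : RatFunc K), (PowerSeries.X : PowerSeries (RatFunc K))] := by
  have hx : AlgebraicIndependent K (fun _ : Unit => (RatFunc.X : RatFunc K)) := by
    rw [algebraicIndependent_unique_type_iff]
    exact RatFunc.transcendental_X
  have hy : AlgebraicIndependent (RatFunc K)
      (fun _ : Unit => (PowerSeries.X : PowerSeries (RatFunc K))) := by
    rw [algebraicIndependent_unique_type_iff, transcendental_iff_injective]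
    intro p q h
    simpa [PowerSeries.aeval_X_eq_coe_map] using h
  have h := (hx.sumElim_comp hy).comp ![Sum.inr (), Sum.inl ()] (by decide)
  convert h using 1
  ext i
  fin_cases i <;> simp

theorem RatFunc.algHom_algebraMap_eq_aeval {K M : Type*} [Field K] [Field M] [Algebra K M]
    (φ : RatFunc K →ₐ[K] M) (p : Polynomial K) :
    φ (algebraMap (Polynomial K) (RatFunc K) p) = Polynomial.aeval (φ RatFunc.X) p := by
  rw [← RatFunc.algebraMap_X, ← IsScalarTower.coe_toAlgHom' K, Polynomial.aeval_algHom_apply,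
    Polynomial.aeval_algHom_apply, Polynomial.aeval_X_left_apply]

theorem RatFunc.algHom_ext_X {K M : Type*} [Field K] [Field M] [Algebra K M]
    {φ ψ : RatFunc K →ₐ[K] M} (h : φ RatFunc.X = ψ RatFunc.X) : φ = ψ := by
  ext r
  induction r using RatFunc.induction_on with
  | f p q hq => simp only [map_div₀, RatFunc.algHom_algebraMap_eq_aeval, h]

/-- A polynomial relation satisfied by `P₁(t₁) + P₂(t₂)` holds after expanding in powers
of `t₂`. -/
theorem aeval_powerSeries_eq_zero {K : Type*} [Field K] {σ : Type*}
    (ι₁ ι₂ : RatFunc K →ₐ[K] Lfield K)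
    (hι₁ : ι₁ RatFunc.X = t₁ K) (hι₂ : ι₂ RatFunc.X = t₂ K)
    (q₁ : σ → RatFunc K) (u v : σ → Polynomial K)
    (hv0 : ∀ i, (v i).eval 0 ≠ 0) (f : MvPolynomial σ K)
    (hf : MvPolynomial.aeval
      (fun i => ι₁ (q₁ i) + ι₂ ((u i : RatFunc K) / (v i : RatFunc K))) f = 0)
    (p : σ → PowerSeries (RatFunc K))
    (hp : ∀ i, p i * Polynomial.aeval PowerSeries.X (v i) =
      PowerSeries.C (q₁ i) * Polynomial.aeval PowerSeries.X (v i) +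
        Polynomial.aeval PowerSeries.X (u i)) :
    MvPolynomial.aeval p f = 0 := by
  let A := PowerSeries (RatFunc K)
  let M := FractionRing A
  let j : A →ₐ[K] M := IsScalarTower.toAlgHom K A M
  have hj : Function.Injective j := IsFractionRing.injective A M
  let g : MvPolynomial (Fin 2) K →ₐ[K] M :=
    j.comp (MvPolynomial.aeval ![PowerSeries.C RatFunc.X, PowerSeries.X])
  have hg : Function.Injective g := hj.comp (algebraicIndependent_ratFunc_X_powerSeries_X K)
  let φ : Lfield K →ₐ[K] M := IsFractionRing.liftAlgHom hg
  have hφ (x : MvPolynomial (Fin 2) K) : φ (algebraMap _ _ x) = g x :=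
    IsFractionRing.lift_algebraMap (g := (g : MvPolynomial (Fin 2) K →+* M)) hg x
  have h₁ : φ.comp ι₁ = j.comp (IsScalarTower.toAlgHom K (RatFunc K) A) := by
    apply RatFunc.algHom_ext_X
    simp [hι₁, t₁, hφ, g, A]
  have h₂ : (φ.comp ι₂) RatFunc.X = j PowerSeries.X := by
    simp [hι₂, t₂, hφ, g]
  have hq (i : σ) : φ (ι₁ (q₁ i)) = j (PowerSeries.C (q₁ i)) :=
    DFunLike.congr_fun h₁ (q₁ i)
  have hpol (w : Polynomial K) :
      φ (ι₂ (w : RatFunc K)) = j (Polynomial.aeval PowerSeries.X w) := by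
    rw [← Polynomial.aeval_algHom_apply, ← h₂]
    exact RatFunc.algHom_algebraMap_eq_aeval (φ.comp ι₂) w
  have hP (i : σ) : φ (ι₁ (q₁ i) + ι₂ ((u i : RatFunc K) / (v i : RatFunc K))) = j (p i) := by
    have hne : j (Polynomial.aeval PowerSeries.X (v i)) ≠ 0 := by
      rw [map_ne_zero_iff j hj]
      intro h
      have h' := congrArg PowerSeries.constantCoeff h
      rw [PowerSeries.constantCoeff_polynomial_aeval_X, map_zero, map_eq_zero] at h'
      exact hv0 i h'
    rw [map_add, map_div₀, map_div₀, hq, hpol, hpol]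
    apply mul_right_cancel₀ hne
    rw [add_mul, div_mul_cancel₀ _ hne, ← map_mul, ← map_mul, ← map_add, hp]
  apply hj
  rw [map_zero, MvPolynomial.comp_aeval_apply]
  have := congrArg φ hf
  rw [map_zero, MvPolynomial.comp_aeval_apply] at this
  rw [← this]
  congr 2
  ext i
  exact (hP i).symm

/-- Theorem 3.1: with `P₂(0) = (0,0,0)` and `a = P₂′(0) ≠ 0`, the curve `P₁` lies on the
space curve `f = g = 0`, where `g = a·∇f`, `g` is not constant, and `f ∤ g`. -/
theorem first_factor_on_space_curve
    (K : Type*) [Field K] [IsAlgClosed K] [CharZero K]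
    (ι₁ ι₂ : RatFunc K →ₐ[K] Lfield K)
    (hι₁ : ι₁ RatFunc.X = t₁ K) (hι₂ : ι₂ RatFunc.X = t₂ K)
    (f : MvPolynomial (Fin 3) K) (hf : Irreducible f) (hnc : NonCylindrical f)
    (q₁ : Fin 3 → RatFunc K) (u v : Fin 3 → Polynomial K)
    (hv : ∀ i, v i ≠ 0)
    (hv0 : ∀ i, (v i).eval 0 ≠ 0)
    (hu0 : ∀ i, (u i).eval 0 = 0)
    (a : Fin 3 → K)
    (ha : a = fun i =>
      ((Polynomial.derivative (u i) * v i - u i * Polynomial.derivative (v i)).eval 0) /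
        ((v i).eval 0) ^ 2)
    (ha0 : a ≠ 0)
    (hpar : Parametrizes f (fun i => ι₁ (q₁ i) + ι₂ ((u i : RatFunc K) / (v i : RatFunc K))))
    (g : MvPolynomial (Fin 3) K)
    (hg : g = ∑ i, a i • MvPolynomial.pderiv i f) :
    (MvPolynomial.aeval q₁) f = 0 ∧
    (MvPolynomial.aeval q₁) g = 0 ∧
    0 < g.totalDegree ∧
    ¬ f ∣ g := by
  have hP := (hpar f).mpr dvd_rfl
  let V (w : Polynomial K) : PowerSeries (RatFunc K) := Polynomial.aeval PowerSeries.X w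
  have hV (w : Polynomial K) (n : ℕ) :
      PowerSeries.coeff n (V w) = algebraMap K (RatFunc K) (w.coeff n) :=
    PowerSeries.coeff_polynomial_aeval_X w n
  have hV0 (w : Polynomial K) :
      PowerSeries.constantCoeff (V w) = algebraMap K (RatFunc K) (w.eval 0) :=
    PowerSeries.constantCoeff_polynomial_aeval_X w
  have hne (i : Fin 3) : algebraMap K (RatFunc K) ((v i).eval 0) ≠ 0 :=
    (map_ne_zero _).mpr (hv0 i)
  let s (i : Fin 3) : PowerSeries (RatFunc K) := V (u i) * (V (v i))⁻¹
  have hs (i : Fin 3) : s i * V (v i) = V (u i) := by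
    rw [mul_assoc, PowerSeries.inv_mul_cancel _ (by rw [hV0]; exact hne i), mul_one]
  let p (i : Fin 3) : PowerSeries (RatFunc K) := PowerSeries.C (q₁ i) + s i
  have hzero : MvPolynomial.aeval p f = 0 :=
    aeval_powerSeries_eq_zero ι₁ ι₂ hι₁ hι₂ q₁ u v hv0 f hP p
      fun i => by rw [add_mul]; exact congrArg _ (hs i)
  have hs0 (i : Fin 3) : PowerSeries.constantCoeff (s i) = 0 := by
    simp [s, hV0, hu0]
  have hp0 : (fun i => PowerSeries.constantCoeff (p i)) = q₁ := by
    ext i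
    simp [p, hs0]
  have hp1 (i : Fin 3) : PowerSeries.coeff 1 (p i) = algebraMap K (RatFunc K) (a i) := by
    have h1 : PowerSeries.coeff 1 (p i) = PowerSeries.coeff 1 (s i) := by
      simp [p]
    have h2 := congrArg (PowerSeries.coeff 1) (hs i)
    rw [PowerSeries.coeff_one_mul, hs0, mul_zero, add_zero, hV0, hV] at h2
    have h3 : a i * (v i).eval 0 = (u i).coeff 1 := by
      have h4 : (u i).derivative.eval 0 = (u i).coeff 1 := by
        simp [← Polynomial.coeff_zero_eq_eval_zero, Polynomial.coeff_derivative]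
      have := hv0 i
      simp only [ha, Polynomial.eval_sub, Polynomial.eval_mul, hu0, h4]
      field_simp
      ring
    rw [h1]
    apply mul_right_cancel₀ (hne i)
    rw [h2, ← h3, map_mul]
  have hfq : MvPolynomial.aeval q₁ f = 0 := by
    have := PowerSeries.constantCoeff_mvPolynomial_aeval p f
    rwa [hzero, hp0, map_zero, eq_comm] at this
  have hgq : MvPolynomial.aeval q₁ g = 0 := by
    have := PowerSeries.coeff_one_mvPolynomial_aeval p f
    rw [hzero, hp0, map_zero] at this
    rw [hg, this, map_sum]
    exact Finset.sum_congr rfl fun i _ => by rw [map_smul, hp1, Algebra.smul_def]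
  have hg0 : g ≠ 0 := hg ▸ hnc a ha0
  have hfdeg : 0 < f.totalDegree := by
    refine Nat.pos_of_ne_zero fun h => hf.not_isUnit ?_
    rw [MvPolynomial.totalDegree_eq_zero_iff_eq_C] at h
    rw [h]
    refine (isUnit_iff_ne_zero.mpr fun h0 => hf.ne_zero ?_).map MvPolynomial.C
    rw [h, h0, map_zero]
  have hdeg : g.totalDegree < f.totalDegree := by
    rw [hg]
    refine lt_of_le_of_lt (MvPolynomial.totalDegree_finsetSum_le fun i _ => ?_)
      (Nat.sub_one_lt hfdeg.ne')
    exact (MvPolynomial.totalDegree_smul_le _ _).trans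
      (Nat.le_sub_one_of_lt (MvPolynomial.totalDegree_pderiv_lt f i hfdeg))
  refine ⟨hfq, hgq, Nat.pos_of_ne_zero fun h => hg0 ?_, ?_⟩
  · rw [MvPolynomial.totalDegree_eq_zero_iff_eq_C] at h
    rw [h, MvPolynomial.aeval_C, map_eq_zero] at hgq
    rw [h, hgq, map_zero]
  · rintro ⟨c, hc⟩
    have hc0 : c ≠ 0 := by
      rintro rfl
      exact hg0 (by rw [hc, mul_zero])
    rw [hc, MvPolynomial.totalDegree_mul_of_isDomain hf.ne_zero hc0] at hdeg
    omega
end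
end

section
/- Let f ∈ MvPolynomial (Fin 3) K be irreducible and non-cylindrical. Let q₁ : Fin 3 → RatFunc K and u, v : Fin 3 → Polynomial K with v i ≠ 0 for all i, and assume the tuple P with P i = ι₁(q₁ i) + ι₂((u i : RatFunc K)/(v i)) parametrizes the surface V(f). Let t₂⁰ ∈ K be such that (v i).eval t₂⁰ ≠ 0 for every i; set a i := ((Polynomial.derivative (u i) * v i − u i * Polynomial.derivative (v i)).eval t₂⁰)/(((v i).eval t₂⁰)²) (the vector P₂′(t₂⁰)) and assume a ≠ 0, and set c i := ((u i).eval t₂⁰)/((v i).eval t₂⁰) (the point P₂(t₂⁰)). Then the shifted curve parametrization Q : Fin 3 → RatFunc K, Q i := q₁ i + algebraMap K (RatFunc K) (c i), satisfies (MvPolynomial.aeval Q) f = 0 and (MvPolynomial.aeval Q) g = 0, where g := ∑ i, a i • (MvPolynomial.pderiv i f) (the curve P₁ + P₂(t₂⁰) lies on the space curve f = g = 0); moreover the tuple i ↦ ι₁(Q i) + (ι₂((u i : RatFunc K)/(v i)) − algebraMap K L (c i)) parametrizes V(f). (Corollary 3.2.) -/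
noncomputable section

open Polynomial in
/-- First-order Taylor expansion of a univariate polynomial over the dual numbers. -/
theorem Polynomial.aeval_inl_add_inr {K F : Type*} [Field K] [Field F] [Algebra K F]
    (p : K[X]) (s d : F) :
    aeval (TrivSqZeroExt.inl s + TrivSqZeroExt.inr d : TrivSqZeroExt F F) p =
      TrivSqZeroExt.inl (aeval s p) + TrivSqZeroExt.inr (aeval s (derivative p) * d) := by
  induction p using Polynomial.induction_on' with
  | add p q hp hq =>
    rw [map_add, hp, hq]
    ext <;> simp [add_mul]
  | monomial n k =>
    ext
    · simp [TrivSqZeroExt.algebraMap_eq_inl']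
    · simp [TrivSqZeroExt.algebraMap_eq_inl', aeval_monomial, derivative_monomial]
      ring

/-- First-order Taylor expansion of a multivariate polynomial over the dual numbers. -/
theorem MvPolynomial.aeval_inl_add_inr {K F σ : Type*} [Field K] [Field F] [Algebra K F]
    [Fintype σ] (p : MvPolynomial σ K) (x d : σ → F) :
    aeval (fun i => (TrivSqZeroExt.inl (x i) + TrivSqZeroExt.inr (d i) : TrivSqZeroExt F F)) p =
      TrivSqZeroExt.inl (aeval x p) +
        TrivSqZeroExt.inr (∑ i, aeval x (pderiv i p) * d i) := by
  classical
  induction p using MvPolynomial.induction_on with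
  | C k => ext <;> simp [TrivSqZeroExt.algebraMap_eq_inl']
  | add p q hp hq =>
    rw [map_add, hp, hq]
    ext <;> simp [add_mul, Finset.sum_add_distrib]
  | mul_X p j hp =>
    rw [map_mul, hp, aeval_X]
    ext
    · simp
    · simp [pderiv_X, Pi.single_apply, add_mul, Finset.sum_add_distrib, Finset.sum_mul]
      simp [apply_ite, mul_right_comm, mul_comm (x j)]

/-- Evaluating polynomials over `K(X)` at `t₂`, along an embedding of `K(X)` that sends `X` to
`t₁`, is injective: `t₂` is transcendental over `K(t₁)`. -/
theorem eval₂_t₂_injective {K : Type*} [Field K] (ι : RatFunc K →ₐ[K] Lfield K)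
    (hι : ι RatFunc.X = t₁ K) :
    Function.Injective (Polynomial.eval₂RingHom (ι : RatFunc K →+* Lfield K) (t₂ K)) := by
  let : Algebra (RatFunc K) (Lfield K) := (ι : RatFunc K →+* Lfield K).toAlgebra
  let : Algebra (Polynomial K) (Lfield K) :=
    ((ι : RatFunc K →+* Lfield K).comp (algebraMap (Polynomial K) (RatFunc K))).toAlgebra
  have : IsScalarTower (Polynomial K) (RatFunc K) (Lfield K) := .of_algebraMap_eq fun _ => rfl
  suffices h : Transcendental (RatFunc K) (t₂ K) from transcendental_iff_injective.mp h
  unfold Transcendental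
  rw [← IsFractionRing.isAlgebraic_iff (Polynomial K) (RatFunc K) (Lfield K)]
  refine transcendental_iff_injective.mpr ?_
  have key : ((Polynomial.aeval (t₂ K) :
        Polynomial (Polynomial K) →ₐ[Polynomial K] Lfield K) :
        Polynomial (Polynomial K) →+* Lfield K) =
      (algebraMap (MvPolynomial (Fin 2) K) (Lfield K)).comp
        (Polynomial.Bivariate.equivMvPolynomial K : _ →+* _) := by
    ext k
    · have := (ι.commutes k).trans
        (IsScalarTower.algebraMap_apply K (MvPolynomial (Fin 2) K) (Lfield K) k)
      simpa [RingHom.algebraMap_toAlgebra] using this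
    · simp [RingHom.algebraMap_toAlgebra, hι, t₁]
    · simp [t₂]
  have h := (IsFractionRing.injective (MvPolynomial (Fin 2) K) (Lfield K)).comp
    (Polynomial.Bivariate.equivMvPolynomial K).injective
  intro p q hpq
  refine h ?_
  have hp := RingHom.congr_fun key p
  have hq := RingHom.congr_fun key q
  exact hp.symm.trans (hpq.trans hq)

open Polynomial in
/-- A polynomial relation satisfied by the functions `q i + u i / v i` of a variable `X` over
a field `F`, read in any field containing `F[X]`, specializes at a point `s` where the `v i` do
not vanish, together with its derivative. -/
theorem aeval_specialize_of_aeval_eq_zero {K F L σ : Type*} [Field K] [Field F]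
    [Field L] [Algebra K F] [Algebra K L] [Fintype σ] (ι : F →ₐ[K] L) (t : L)
    (hinj : Function.Injective (eval₂RingHom (ι : F →+* L) t))
    (f : MvPolynomial σ K) (q : σ → F) (u v : σ → K[X]) (s : K)
    (hv : ∀ i, (v i).eval s ≠ 0)
    (h : MvPolynomial.aeval (fun i => ι (q i) + aeval t (u i) / aeval t (v i)) f = 0) :
    MvPolynomial.aeval (fun i => q i + algebraMap K F ((u i).eval s / (v i).eval s)) f = 0 ∧
    ∑ i, MvPolynomial.aeval (fun i => q i + algebraMap K F ((u i).eval s / (v i).eval s))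
        (MvPolynomial.pderiv i f) *
      algebraMap K F ((derivative (u i) * v i - u i * derivative (v i)).eval s /
        ((v i).eval s) ^ 2) = 0 := by
  let φ : F[X] →ₐ[K] L :=
    { eval₂RingHom (ι : F →+* L) t with
      commutes' := fun k => by
        simp [IsScalarTower.algebraMap_apply K F F[X]] }
  have hφinj : Function.Injective φ := hinj
  let s' : F := algebraMap K F s
  let θ : F[X] →ₐ[K] TrivSqZeroExt F F :=
    (aeval (TrivSqZeroExt.inl s' + TrivSqZeroExt.inr 1 : TrivSqZeroExt F F)).restrictScalars K
  let M : Submonoid F[X] := (nonZeroDivisors F).comap (evalRingHom s')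
  have hMφ (m : M) : IsUnit (φ m) := by
    refine isUnit_iff_ne_zero.mpr fun h0 => ?_
    have hm : (m : F[X]) = 0 := hφinj (h0.trans (map_zero φ).symm)
    exact nonZeroDivisors.ne_zero m.2 (by simp [hm])
  have hMθ (m : M) : IsUnit (θ m) := by
    refine TrivSqZeroExt.isUnit_iff_isUnit_fst.mpr (isUnit_iff_ne_zero.mpr ?_)
    have := nonZeroDivisors.ne_zero m.2
    have hm : θ m = _ := Polynomial.aeval_inl_add_inr (m : F[X]) s' 1
    simpa [hm, coe_aeval_eq_eval] using this
  let Φ : Localization M →ₐ[K] L := IsLocalization.liftAlgHom (M := M) (f := φ) hMφ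
  let Θ : Localization M →ₐ[K] TrivSqZeroExt F F :=
    IsLocalization.liftAlgHom (M := M) (f := θ) hMθ
  have hΦ (x : F[X]) : Φ (algebraMap _ _ x) = φ x := IsLocalization.lift_eq _ _
  have hΘ (x : F[X]) : Θ (algebraMap _ _ x) = θ x := IsLocalization.lift_eq _ _
  have hM : M ≤ nonZeroDivisors F[X] := fun m hm =>
    mem_nonZeroDivisors_of_ne_zero fun h0 => nonZeroDivisors.ne_zero hm (by simp [h0])
  have hΦinj : Function.Injective Φ := by
    refine (IsLocalization.lift_injective_iff (M := M) _).mpr fun x y => ?_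
    exact ((IsLocalization.injective (Localization M) hM).eq_iff).trans hφinj.eq_iff.symm
  have hcast (w : K[X]) : φ (w.map (algebraMap K F)) = aeval t w := by
    simp [φ, eval₂_map, aeval_def]
  have hcast' (w : K[X]) : θ (w.map (algebraMap K F)) =
      TrivSqZeroExt.inl (algebraMap K F (w.eval s)) +
        TrivSqZeroExt.inr (algebraMap K F ((derivative w).eval s)) := by
    change aeval _ (w.map (algebraMap K F)) = _
    rw [aeval_map_algebraMap, Polynomial.aeval_inl_add_inr, mul_one,
      aeval_algebraMap_apply_eq_algebraMap_eval, aeval_algebraMap_apply_eq_algebraMap_eval]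
  have hvM (i : σ) : (v i).map (algebraMap K F) ∈ M := by
    refine mem_nonZeroDivisors_of_ne_zero ?_
    simpa [s', eval_map_algebraMap, aeval_algebraMap_apply] using hv i
  let y : σ → Localization M := fun i =>
    IsLocalization.mk' (Localization M) ((u i).map (algebraMap K F)) ⟨_, hvM i⟩
  have hy (i : σ) : y i * algebraMap F[X] _ ((v i).map (algebraMap K F)) =
      algebraMap F[X] _ ((u i).map (algebraMap K F)) := IsLocalization.mk'_spec _ _ _
  let p : σ → Localization M := fun i => algebraMap F[X] _ (C (q i)) + y i
  have hpΦ (i : σ) : Φ (p i) = ι (q i) + aeval t (u i) / aeval t (v i) := by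
    have hne : aeval t (v i) ≠ 0 := by
      have := (hMφ ⟨_, hvM i⟩).ne_zero
      rwa [hcast] at this
    have := congrArg Φ (hy i)
    rw [map_mul, hΦ, hΦ, hcast, hcast] at this
    rw [map_add, hΦ, eq_div_of_mul_eq hne this]
    simp [φ]
  have hpΘ (i : σ) : Θ (p i) =
      TrivSqZeroExt.inl (q i + algebraMap K F ((u i).eval s / (v i).eval s)) +
      TrivSqZeroExt.inr (algebraMap K F ((derivative (u i) * v i - u i * derivative (v i)).eval s /
        ((v i).eval s) ^ 2)) := by
    have hne : algebraMap K F ((v i).eval s) ≠ 0 := by simpa using hv i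
    have hunit := hMθ ⟨_, hvM i⟩
    have := congrArg Θ (hy i)
    rw [map_mul, hΘ, hΘ] at this
    have hyi : Θ (y i) = TrivSqZeroExt.inl (algebraMap K F ((u i).eval s / (v i).eval s)) +
      TrivSqZeroExt.inr (algebraMap K F ((derivative (u i) * v i - u i * derivative (v i)).eval s /
        ((v i).eval s) ^ 2)) := by
      refine hunit.mul_right_cancel (this.trans ?_)
      rw [hcast', hcast']
      ext
      · simp
        field_simp
      · simp [-algebraMap_smul]
        field_simp
        ring
    rw [map_add, hΘ, hyi]
    simp [θ, TrivSqZeroExt.algebraMap_eq_inl, add_assoc]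
  have hzero : MvPolynomial.aeval p f = 0 := by
    refine hΦinj ?_
    rw [map_zero, MvPolynomial.comp_aeval_apply]
    simpa only [hpΦ] using h
  have hdual := congrArg Θ hzero
  rw [map_zero, MvPolynomial.comp_aeval_apply] at hdual
  simp only [hpΘ, MvPolynomial.aeval_inl_add_inr] at hdual
  exact ⟨by simpa using congrArg TrivSqZeroExt.fst hdual,
    by simpa using congrArg TrivSqZeroExt.snd hdual⟩

/-- Corollary 3.2: for every `t₂⁰` with `a = P₂′(t₂⁰) ≠ 0`, the shifted curve
`P₁ + P₂(t₂⁰)` lies on the space curve `f = g = 0` with `g = a·∇f`, and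
`(P₁ + P₂(t₂⁰)) + (P₂ − P₂(t₂⁰))` parametrizes `V(f)`. -/
theorem shifted_first_factor_on_space_curve
    (K : Type*) [Field K] [IsAlgClosed K] [CharZero K]
    (ι₁ ι₂ : RatFunc K →ₐ[K] Lfield K)
    (hι₁ : ι₁ RatFunc.X = t₁ K) (hι₂ : ι₂ RatFunc.X = t₂ K)
    (f : MvPolynomial (Fin 3) K) (hf : Irreducible f) (hnc : NonCylindrical f)
    (q₁ : Fin 3 → RatFunc K) (u v : Fin 3 → Polynomial K)
    (hv : ∀ i, v i ≠ 0)
    (hpar : Parametrizes f (fun i => ι₁ (q₁ i) + ι₂ ((u i : RatFunc K) / (v i : RatFunc K))))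
    (t₂0 : K) (hv0 : ∀ i, (v i).eval t₂0 ≠ 0)
    (a : Fin 3 → K)
    (ha : a = fun i =>
      ((Polynomial.derivative (u i) * v i - u i * Polynomial.derivative (v i)).eval t₂0) /
        ((v i).eval t₂0) ^ 2)
    (ha0 : a ≠ 0)
    (c : Fin 3 → K)
    (hc : c = fun i => ((u i).eval t₂0) / ((v i).eval t₂0))
    (Q : Fin 3 → RatFunc K)
    (hQ : Q = fun i => q₁ i + algebraMap K (RatFunc K) (c i))
    (g : MvPolynomial (Fin 3) K)
    (hg : g = ∑ i, a i • MvPolynomial.pderiv i f) :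
    (MvPolynomial.aeval Q) f = 0 ∧
    (MvPolynomial.aeval Q) g = 0 ∧
    Parametrizes f (fun i =>
      ι₁ (Q i) + (ι₂ ((u i : RatFunc K) / (v i : RatFunc K)) - algebraMap K (Lfield K) (c i))) := by
  subst hQ hg
  have hι₂' (w : Polynomial K) : ι₂ (w : RatFunc K) = Polynomial.aeval (t₂ K) w := by
    rw [RatFunc.coePolynomial_eq_algebraMap, ← hι₂, Polynomial.aeval_algHom_apply,
      ← RatFunc.algebraMap_X, Polynomial.aeval_algebraMap_apply, Polynomial.aeval_X_left_apply]
  have hzero := (hpar f).mpr dvd_rfl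
  simp only [map_div₀, hι₂'] at hzero
  obtain ⟨h0, h1⟩ := aeval_specialize_of_aeval_eq_zero ι₁ (t₂ K)
    (eval₂_t₂_injective ι₁ hι₁) f q₁ u v t₂0 hv0 hzero
  subst ha hc
  refine ⟨h0, ?_, ?_⟩
  · rw [map_sum, ← h1]
    refine Finset.sum_congr rfl fun i _ => ?_
    rw [map_smul, Algebra.smul_def, mul_comm]
  · convert hpar using 2 with i
    rw [map_add, AlgHom.commutes]
    ring
end
end

section
/- Let f ∈ MvPolynomial (Fin 3) K be irreducible and non-cylindrical. Let q₁, q₂ : Fin 3 → RatFunc K each have some component not in the image of algebraMap K (RatFunc K) (both nonconstant), and suppose (MvPolynomial.aeval (fun i => ι₁(q₁ i) + ι₂(q₂ i))) f = 0 in L (the translational parametrization P₁(t₁)+P₂(t₂) lies on V(f)). Let F := f(X + P₁) ∈ MvPolynomial (Fin 3) (RatFunc K). Then for every non-constant A ∈ MvPolynomial (Fin 3) K whose coefficient-wise image in MvPolynomial (Fin 3) (RatFunc K) divides F, one has (MvPolynomial.aeval q₂) A ≠ 0. (Key step of Theorem 3.5, 1 ⇒ 3: no nonconstant factor of f(P₁(t₁)+x)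 lying in K[x₁,x₂,x₃] vanishes on the curve C₂; consequently Ψ(P₂(t₂),t₁) = 0 and C₂ ⊂ V(h̃₀,…,h̃ₙ).) -/
noncomputable section

/-- `f(X + P₁)`: map the coefficients of `f` into `RatFunc K` and substitute
`Xᵢ ↦ Xᵢ + q₁ i`. -/
def shiftedPoly {K : Type*} [Field K] (f : MvPolynomial (Fin 3) K)
    (q₁ : Fin 3 → RatFunc K) : MvPolynomial (Fin 3) (RatFunc K) :=
  (MvPolynomial.aeval fun i => MvPolynomial.X i + MvPolynomial.C (q₁ i))
    (MvPolynomial.map (algebraMap K (RatFunc K)) f)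

open MvPolynomial in
/-- The automorphism `Xᵢ ↦ Xᵢ + vᵢ` of a polynomial ring. -/
def translateEquiv {σ R : Type*} [CommRing R] (v : σ → R) :
    MvPolynomial σ R ≃ₐ[R] MvPolynomial σ R :=
  AlgEquiv.ofAlgHom (aeval fun i => X i + C (v i)) (aeval fun i => X i + C (-v i))
    (by ext; simp [algHom_C]) (by ext; simp [algHom_C])

open MvPolynomial in
@[simp]
theorem translateEquiv_X {σ R : Type*} [CommRing R] (v : σ → R) (i : σ) :
    translateEquiv v (X i) = X i + C (v i) := by
  simp [translateEquiv]

open MvPolynomial in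
@[simp]
theorem translateEquiv_C {σ R : Type*} [CommRing R] (v : σ → R) (a : R) :
    translateEquiv v (C a) = C a :=
  (translateEquiv v).commutes a

open MvPolynomial in
theorem translateEquiv_map {σ R S : Type*} [CommRing R] [CommRing S] (φ : R →+* S)
    (v : σ → R) (p : MvPolynomial σ R) :
    map φ (translateEquiv v p) = translateEquiv (fun i => φ (v i)) (map φ p) := by
  induction p using MvPolynomial.induction_on with
  | C a => simp
  | add p q hp hq => simp [hp, hq]
  | mul_X p i hp => simp [hp]

open MvPolynomial in
/-- The translate `f(X + s v)`, as a polynomial in the scalar `s`. -/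
def lineTranslate {σ R : Type*} [CommRing R] (v : σ → R) :
    MvPolynomial σ R →ₐ[R] Polynomial (MvPolynomial σ R) :=
  aeval fun i => Polynomial.C (X i) + Polynomial.C (C (v i)) * Polynomial.X

open MvPolynomial in
theorem lineTranslate_C {σ R : Type*} [CommRing R] (v : σ → R) (a : R) :
    lineTranslate v (C a) = Polynomial.C (C a) := by
  simp only [lineTranslate, algHom_C]
  rfl

open MvPolynomial in
theorem lineTranslate_X {σ R : Type*} [CommRing R] (v : σ → R) (i : σ) :
    lineTranslate v (X i) = Polynomial.C (X i) + Polynomial.C (C (v i)) * Polynomial.X := by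
  simp [lineTranslate]

open MvPolynomial in
theorem eval_zero_lineTranslate {σ R : Type*} [CommRing R] (v : σ → R) (p : MvPolynomial σ R) :
    (lineTranslate v p).eval 0 = p := by
  induction p using MvPolynomial.induction_on with
  | C a => simp
  | add p q hp hq => simp [hp, hq]
  | mul_X p i hp => simp [hp, lineTranslate_X]

open MvPolynomial in
theorem eval_zero_derivative_lineTranslate {σ R : Type*} [CommRing R] [Fintype σ] (v : σ → R)
    (p : MvPolynomial σ R) :
    (lineTranslate v p).derivative.eval 0 = ∑ i, v i • pderiv i p := by
  classical
  induction p using MvPolynomial.induction_on with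
  | C a => simp
  | add p q hp hq => simp [hp, hq, Finset.sum_add_distrib]
  | mul_X p i hp =>
    simp only [lineTranslate_X, eval_zero_lineTranslate, pderiv_X, Pi.single_apply, hp, map_mul,
      Polynomial.derivative_mul, Polynomial.derivative_add, Polynomial.derivative_C,
      Polynomial.derivative_X, Polynomial.eval_add, Polynomial.eval_mul, Polynomial.eval_C,
      Polynomial.eval_X, Derivation.leibniz, smul_eq_mul, smul_add, Finset.sum_add_distrib,
      smul_eq_C_mul, Finset.sum_mul]
    simp [mul_comm, mul_left_comm, add_comm]

open MvPolynomial in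
theorem lineTranslate_comp_X_add_one {σ R : Type*} [CommRing R] (v : σ → R)
    (p : MvPolynomial σ R) :
    (lineTranslate v p).comp (Polynomial.X + 1) = lineTranslate v (translateEquiv v p) := by
  induction p using MvPolynomial.induction_on with
  | C a => simp
  | add p q hp hq => simp [hp, hq]
  | mul_X p i hp => simp [hp, lineTranslate_X]; ring

/-- A polynomial of characteristic zero that is multiplied by a constant under `s ↦ s + 1` is
constant. -/
theorem Polynomial.derivative_eq_zero_of_comp_X_add_one {R : Type*} [CommRing R] [IsDomain R]
    [CharZero R] {g : Polynomial R} {c : R}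
    (h : g.comp (Polynomial.X + 1) = Polynomial.C c * g) : g.derivative = 0 := by
  rcases eq_or_ne g 0 with rfl | hg
  · simp
  have hc : c = 1 := by
    have h1 : (Polynomial.X + 1 : Polynomial R) = Polynomial.X + Polynomial.C 1 := by simp
    have h2 := congrArg Polynomial.leadingCoeff h
    rw [h1, Polynomial.leadingCoeff_comp (by rw [Polynomial.natDegree_X_add_C]; exact one_ne_zero), Polynomial.leadingCoeff_X_add_C, one_pow,
      mul_one, Polynomial.leadingCoeff_mul, Polynomial.leadingCoeff_C] at h2
    exact (mul_eq_right₀ (Polynomial.leadingCoeff_ne_zero.mpr hg)).mp h2.symm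
  subst hc
  have heval (n : ℕ) : g.eval (n : R) = g.eval 0 := by
    induction n with
    | zero => simp
    | succ n ih =>
      rw [← ih]
      simpa using congrArg (Polynomial.eval (n : R)) h
  have hconst : g = Polynomial.C (g.eval 0) := by
    refine Polynomial.eq_of_infinite_eval_eq _ _ ((Set.infinite_range_of_injective
      (Nat.cast_injective (R := R))).mono ?_)
    rintro _ ⟨n, rfl⟩
    simp [heval n]
  rw [hconst, Polynomial.derivative_C]

theorem NonCylindrical.eq_of_associated_translate {K : Type*} [Field K] [CharZero K]
    {f : MvPolynomial (Fin 3) K} (hf : NonCylindrical f) {a b : Fin 3 → K}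
    (h : Associated (translateEquiv a f) (translateEquiv b f)) : a = b := by
  have hshift : translateEquiv (b - a) f = (translateEquiv a).symm (translateEquiv b f) := by
    rw [AlgEquiv.eq_symm_apply, ← AlgEquiv.trans_apply]
    refine DFunLike.congr_fun (f := ((translateEquiv (b - a)).trans (translateEquiv a)).toAlgHom)
      (g := (translateEquiv b).toAlgHom) ?_ f
    ext i : 1
    simp
  obtain ⟨u, hu⟩ := h
  obtain ⟨c, -, hc⟩ := MvPolynomial.isUnit_iff_eq_C_of_isReduced.mp u.isUnit
  have hmul : translateEquiv (b - a) f = MvPolynomial.C c * f := by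
    rw [hshift, ← hu, map_mul, AlgEquiv.symm_apply_apply, hc,
      (AlgEquiv.symm_apply_eq _).mpr (translateEquiv_C a c).symm, mul_comm]
  have hcomp : (lineTranslate (b - a) f).comp (Polynomial.X + 1) =
      Polynomial.C (MvPolynomial.C c) * lineTranslate (b - a) f := by
    rw [lineTranslate_comp_X_add_one, hmul, map_mul, lineTranslate_C]
  have hderiv := eval_zero_derivative_lineTranslate (b - a) f
  rw [Polynomial.derivative_eq_zero_of_comp_X_add_one hcomp, Polynomial.eval_zero] at hderiv
  by_contra hab
  exact hf (b - a) (sub_ne_zero.mpr (Ne.symm hab)) hderiv.symm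

/-- Points of a reduced affine variety over an algebraically closed field separate functions
from zero. -/
theorem exists_algHom_apply_ne_zero {K R : Type*} [Field K] [IsAlgClosed K] [CommRing R]
    [IsReduced R] [Algebra K R] [Algebra.FiniteType K R] {x : R} (hx : x ≠ 0) :
    ∃ φ : R →ₐ[K] K, φ x ≠ 0 := by
  have : IsJacobsonRing R := isJacobsonRing_of_finiteType (A := K)
  have hjac : x ∉ (⊥ : Ideal R).jacobson := by
    rw [← Ideal.radical_eq_jacobson]
    rintro ⟨n, hn⟩
    exact hx (eq_zero_of_pow_eq_zero hn)
  simp only [Ideal.jacobson, Ideal.mem_sInf, not_forall] at hjac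
  obtain ⟨m, ⟨-, hm⟩, hxm⟩ := hjac
  let := Ideal.Quotient.field m
  have : Module.Finite K (R ⧸ m) := finite_of_finite_type_of_isJacobsonRing K (R ⧸ m)
  let e := AlgEquiv.ofBijective (Algebra.ofId K (R ⧸ m))
    IsAlgClosed.algebraMap_bijective_of_isIntegral
  refine ⟨e.symm.toAlgHom.comp (Ideal.Quotient.mkₐ K m), ?_⟩
  simpa [Ideal.Quotient.eq_zero_iff_mem] using hxm

open MvPolynomial in
/-- If a nonconstant polynomial over `K` divides a translate of the non-cylindrical irreducible
polynomial `f` by a vector with entries in an extension domain `E`, then that vector is defined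
over `K`. -/
theorem NonCylindrical.mem_range_of_map_dvd_translate {K E : Type*} [Field K] [IsAlgClosed K]
    [CharZero K] [CommRing E] [IsDomain E] [Algebra K E] {f : MvPolynomial (Fin 3) K}
    (hf : Irreducible f) (hnc : NonCylindrical f) {q : Fin 3 → E} {A : MvPolynomial (Fin 3) K}
    (hA : 0 < A.totalDegree)
    (hdvd : map (algebraMap K E) A ∣ translateEquiv q (map (algebraMap K E) f)) (i : Fin 3) :
    q i ∈ Set.range (algebraMap K E) := by
  obtain ⟨B, hB⟩ := hdvd
  let S : Set E := Set.range q ∪ B.coeffs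
  have hS : S.Finite := (Set.finite_range q).union B.coeffs.finite_toSet
  let R := Algebra.adjoin K S
  have : Algebra.FiniteType K R := Algebra.FiniteType.adjoin_of_finite hS
  let r (j : Fin 3) : R := ⟨q j, Algebra.subset_adjoin (Or.inl ⟨j, rfl⟩)⟩
  obtain ⟨B', hB'⟩ : ∃ B', map R.val.toRingHom B' = B := by
    refine (mem_range_map_iff_coeffs_subset (f := R.val.toRingHom)).mpr ?_
    intro x hx
    exact ⟨⟨x, Algebra.subset_adjoin (Or.inr hx)⟩, rfl⟩
  have hval : Function.Injective R.val.toRingHom := Subtype.val_injective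
  have hcomp : R.val.toRingHom.comp (algebraMap K R) = algebraMap K E := rfl
  have hR : translateEquiv r (map (algebraMap K R) f) = map (algebraMap K R) A * B' := by
    refine map_injective _ hval ?_
    rw [translateEquiv_map, map_mul, map_map, map_map, hcomp, hB']
    exact hB
  have hassoc (φ : R →ₐ[K] K) : Associated A (translateEquiv (fun j => φ (r j)) f) := by
    have hφ : (φ : R →+* K).comp (algebraMap K R) = RingHom.id K := by
      ext; simp
    have h := congrArg (map (φ : R →+* K)) hR
    rw [translateEquiv_map, map_mul, map_map, map_map, hφ, map_id, map_id] at h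
    have hirr : Irreducible (translateEquiv (fun j => φ (r j)) f) :=
      (MulEquiv.irreducible_iff (translateEquiv fun j => φ (r j))).mpr hf
    refine (hirr.dvd_iff.mp ⟨_, h⟩).resolve_left ?_ |>.symm
    intro hu
    obtain ⟨c, -, rfl⟩ := isUnit_iff_eq_C_of_isReduced.mp hu
    simp at hA
  obtain ⟨ψ, -⟩ := exists_algHom_apply_ne_zero (K := K) (one_ne_zero (α := R))
  suffices h : r i = algebraMap K R (ψ (r i)) from ⟨ψ (r i), congrArg R.val h.symm⟩
  by_contra hne
  obtain ⟨φ, hφ⟩ := exists_algHom_apply_ne_zero (K := K) (sub_ne_zero.mpr hne)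
  have heq := hnc.eq_of_associated_translate ((hassoc φ).symm.trans (hassoc ψ))
  exact hφ (by simpa [sub_eq_zero] using congrFun heq i)

/-- Key step of Theorem 3.5 (1 ⇒ 3): no nonconstant factor of `f(P₁(t₁)+x)` lying in
`K[x₁,x₂,x₃]` vanishes on the curve `C₂`. -/
theorem no_constant_factor_vanishes_on_second_curve
    (K : Type*) [Field K] [IsAlgClosed K] [CharZero K]
    (ι₁ ι₂ : RatFunc K →ₐ[K] Lfield K)
    (hι₁ : ι₁ RatFunc.X = t₁ K) (hι₂ : ι₂ RatFunc.X = t₂ K)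
    (f : MvPolynomial (Fin 3) K) (hf : Irreducible f) (hnc : NonCylindrical f)
    (q₁ q₂ : Fin 3 → RatFunc K)
    (hq₁ : ∃ i, q₁ i ∉ Set.range (algebraMap K (RatFunc K)))
    (hq₂ : ∃ i, q₂ i ∉ Set.range (algebraMap K (RatFunc K)))
    (hzero : (MvPolynomial.aeval fun i => ι₁ (q₁ i) + ι₂ (q₂ i)) f = 0)
    (F : MvPolynomial (Fin 3) (RatFunc K)) (hF : F = shiftedPoly f q₁) :
    ∀ A : MvPolynomial (Fin 3) K, 0 < A.totalDegree →
      MvPolynomial.map (algebraMap K (RatFunc K)) A ∣ F →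
      (MvPolynomial.aeval q₂) A ≠ 0 := by
  intro A hA hdvd
  obtain ⟨i, hi⟩ := hq₁
  rw [hF] at hdvd
  exact absurd (hnc.mem_range_of_map_dvd_translate hf hA hdvd i) hi
end
end

section
/- Let K be an algebraically closed field, let d ≥ 1, and let f ∈ MvPolynomial (Fin 3) K be homogeneous of degree d (MvPolynomial.IsHomogeneous f d). Then there exists a vector a : Fin 3 → K with a ≠ 0, MvPolynomial.eval a f = 0, a i = 1 for some index i, and a j = 0 for some index j (in particular the product of the three coordinates of a is zero). (Lemma 4.4: the conical surface W defined by a homogeneous polynomial contains a nonzero point (a₁,a₂,a₃) with a₁a₂a₃ = 0 and some coordinate equal to 1.) -/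
noncomputable section

/-- The coefficient of `X ^ d` in the dehomogenization `f(X, 1, 0)` of a ternary form of
degree `d` is `f(1, 0, 0)`. -/
lemma MvPolynomial.IsHomogeneous.coeff_aeval_X_one_zero {R : Type*} [CommRing R] {d : ℕ}
    {f : MvPolynomial (Fin 3) R} (hf : f.IsHomogeneous d) :
    (MvPolynomial.aeval ![(Polynomial.X : Polynomial R), 1, 0] f).coeff d =
      MvPolynomial.eval ![1, 0, 0] f := by
  rw [MvPolynomial.aeval_def, MvPolynomial.eval₂_eq', MvPolynomial.eval_eq',
    Polynomial.finsetSum_coeff]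
  refine Finset.sum_congr rfl fun m hm => ?_
  have hdeg : m 0 + m 1 + m 2 = d := by
    have h := hf (MvPolynomial.mem_support_iff.mp hm)
    rw [Finsupp.weight_apply, Finsupp.sum_fintype _ _ (by simp)] at h
    simpa [Fin.sum_univ_three] using h
  rw [← Polynomial.C_eq_algebraMap, Polynomial.coeff_C_mul]
  congr 1
  simp only [Fin.prod_univ_three, Matrix.cons_val_zero, Matrix.cons_val_one, Matrix.cons_val,
    one_pow, mul_one, one_mul]
  rcases Nat.eq_zero_or_pos (m 2) with h2 | h2
  · rcases Nat.eq_zero_or_pos (m 1) with h1 | h1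
    · simp [h1, h2, Polynomial.coeff_X_pow, ← hdeg]
    · have hne : d ≠ m 0 := by omega
      simp [h2, h1.ne', Polynomial.coeff_X_pow, hne]
  · simp [h2.ne']

/-- Lemma 4.4: a conical surface defined by a homogeneous polynomial of degree `d ≥ 1`
over an algebraically closed field contains a nonzero point with some coordinate equal
to `1` and some coordinate equal to `0`. -/
theorem homogeneous_has_normalized_zero
    (K : Type*) [Field K] [IsAlgClosed K]
    (d : ℕ) (hd : 1 ≤ d)
    (f : MvPolynomial (Fin 3) K) (hf : f.IsHomogeneous d) :
    ∃ a : Fin 3 → K, a ≠ 0 ∧ MvPolynomial.eval a f = 0 ∧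
      (∃ i, a i = 1) ∧ (∃ j, a j = 0) := by
  set p := MvPolynomial.aeval ![(Polynomial.X : Polynomial K), 1, 0] f with hp
  by_cases hdeg : p.degree = 0
  · have hzero : MvPolynomial.eval ![1, 0, 0] f = 0 := by
      rw [← hf.coeff_aeval_X_one_zero]
      refine Polynomial.coeff_eq_zero_of_degree_lt ?_
      rw [← hp, hdeg]
      exact_mod_cast hd
    exact ⟨![1, 0, 0], fun h => one_ne_zero (congrFun h 0), hzero, ⟨0, rfl⟩, ⟨1, rfl⟩⟩
  · obtain ⟨x, hx⟩ := IsAlgClosed.exists_root p hdeg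
    refine ⟨![x, 1, 0], fun h => one_ne_zero (congrFun h 1), ?_, ⟨1, rfl⟩, ⟨2, rfl⟩⟩
    have hcomp : Polynomial.aeval x p = MvPolynomial.eval ![x, 1, 0] f := by
      have h := MvPolynomial.comp_aeval_apply (f := ![(Polynomial.X : Polynomial K), 1, 0])
        (Polynomial.aeval x) f
      rw [hp, h, ← MvPolynomial.coe_aeval_eq_eval]
      refine congrArg (fun g => MvPolynomial.aeval g f) (funext fun i => ?_)
      fin_cases i <;> simp
    rw [← hcomp, Polynomial.coe_aeval_eq_eval]
    exact hx
end
end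

section
/- Let f ∈ MvPolynomial (Fin 3) K and w : Fin 3 → RatFunc K, and suppose the tuple P : Fin 3 → L with P i = t₁ * ι₂(w i) parametrizes the surface V(f) (so V(f) is the rational conical surface parametrized by Q(t₁,t₂) = t₁·(w₁(t₂), w₂(t₂), w₃(t₂))). Then f is homogeneous: MvPolynomial.IsHomogeneous f f.totalDegree. (Claim in the proof of Lemma 4.4: the implicit polynomial of a rational conical surface is homogeneous in x₁, x₂, x₃.) -/
noncomputable section

open MvPolynomial in
/-- The generator `t₁` is transcendental over the image of `K(t₂)`, in coefficient form. -/
theorem eq_zero_of_sum_t₁_pow_mul_eq_zero {K : Type*} [Field K]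
    (ι : RatFunc K →ₐ[K] Lfield K) (hι : ι RatFunc.X = t₂ K) (s : Finset ℕ)
    (c : ℕ → RatFunc K) (h : ∑ d ∈ s, t₁ K ^ d * ι (c d) = 0) {d : ℕ} (hd : d ∈ s) :
    c d = 0 := by
  obtain ⟨b, hb⟩ := IsLocalization.exist_integer_multiples (nonZeroDivisors (Polynomial K)) s c
  choose! a ha using hb
  have hb0 : algebraMap (Polynomial K) (RatFunc K) b ≠ 0 := by
    simp
  have hpoly (p : Polynomial K) : ι (algebraMap (Polynomial K) (RatFunc K) p) =
      algebraMap (MvPolynomial (Fin 2) K) (Lfield K) (Polynomial.aeval (X 1) p) := by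
    have hX : (IsScalarTower.toAlgHom K (Polynomial K) (RatFunc K)) Polynomial.X = RatFunc.X :=
      RatFunc.algebraMap_X
    rw [← Polynomial.aeval_algebraMap_apply, ← t₂, ← hι, Polynomial.aeval_algHom_apply, ← hX,
      Polynomial.aeval_algHom_apply, Polynomial.aeval_X_left_apply]
    rfl
  have hsum : ∑ e ∈ s, (X 0 : MvPolynomial (Fin 2) K) ^ e * Polynomial.aeval (X 1) (a e) = 0 := by
    apply IsFractionRing.injective (MvPolynomial (Fin 2) K) (Lfield K)
    have hmul := congrArg (ι (algebraMap (Polynomial K) (RatFunc K) b) * ·) h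
    simp only [Finset.mul_sum, mul_zero] at hmul
    rw [map_zero, ← hmul, map_sum]
    refine Finset.sum_congr rfl fun e he => ?_
    rw [map_mul, map_pow, ← hpoly, ha e he, Algebra.smul_def, map_mul]
    simp only [t₁]
    ring
  have hcoeff := congrArg
    (fun q => (aeval ![(Polynomial.X : Polynomial (Polynomial K)),
      Polynomial.C Polynomial.X] q).coeff d) hsum
  have haC (p : Polynomial K) :
      Polynomial.aeval (Polynomial.C Polynomial.X : Polynomial (Polynomial K)) p =
        Polynomial.C p := by
    simpa using Polynomial.aeval_algebraMap_apply (Polynomial (Polynomial K))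
      (Polynomial.X : Polynomial K) p
  have had : a d = 0 := by
    simpa [← Polynomial.aeval_algHom_apply, haC, Polynomial.finsetSum_coeff,
      Polynomial.coeff_X_pow_mul', Polynomial.coeff_mul_C, Polynomial.coeff_X_pow, hd] using hcoeff
  have := ha d hd
  rw [had, map_zero, Algebra.smul_def] at this
  exact (mul_eq_zero.mp this.symm).resolve_left hb0

open MvPolynomial in
/-- A polynomial over a domain dividing its top homogeneous component is homogeneous. -/
theorem isHomogeneous_of_dvd_homogeneousComponent_totalDegree {σ R : Type*} [CommRing R]
    [IsDomain R] {f : MvPolynomial σ R} (h : f ∣ homogeneousComponent f.totalDegree f) :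
    f.IsHomogeneous f.totalDegree := by
  by_cases hf : f = 0
  · subst hf
    exact isHomogeneous_zero σ R _
  have htop : homogeneousComponent f.totalDegree f ≠ 0 := by
    obtain ⟨m, hm, hdeg⟩ := f.support.exists_mem_eq_sup (support_nonempty.mpr hf)
      fun m => m.degree
    intro h0
    have hc := congrArg (coeff m) h0
    have hmd : m.degree = f.totalDegree := hdeg.symm
    rw [coeff_homogeneousComponent, if_pos hmd, coeff_zero] at hc
    exact mem_support_iff.mp hm hc
  obtain ⟨g, hg⟩ := h
  have hg0 : g ≠ 0 := by
    rintro rfl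
    exact htop (by simpa using hg)
  have hdeg := (homogeneousComponent_isHomogeneous f.totalDegree f).totalDegree htop
  rw [hg, totalDegree_mul_of_isDomain hf hg0] at hdeg
  obtain ⟨r, rfl⟩ : ∃ r, g = C r := ⟨_, totalDegree_eq_zero_iff_eq_C.mp (by omega)⟩
  have hr : r ≠ 0 := by
    rintro rfl
    exact hg0 C_0
  intro m hm
  refine homogeneousComponent_isHomogeneous f.totalDegree f ?_
  rw [hg, mul_comm, coeff_C_mul]
  exact mul_ne_zero hr hm

/-- Scaling the arguments of a homogeneous polynomial scales its value by a power. -/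
theorem MvPolynomial.aeval_mul_left_of_isHomogeneous {σ R A : Type*} [CommSemiring R]
    [CommSemiring A] [Algebra R A] {g : MvPolynomial σ R} {d : ℕ} (hg : g.IsHomogeneous d)
    (t : A) (x : σ → A) :
    aeval (fun i => t * x i) g = t ^ d * aeval x g := by
  simp only [aeval_def, eval₂_eq, Finset.mul_sum]
  refine Finset.sum_congr rfl fun m hm => ?_
  rw [hg.degree_eq_sum_deg_support hm]
  simp only [mul_pow, Finset.prod_mul_distrib, Finset.prod_pow_eq_pow_sum]
  ring

/-- Claim in the proof of Lemma 4.4: the implicit polynomial of a rational conical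
surface `Q(t₁,t₂) = t₁·(w₁(t₂), w₂(t₂), w₃(t₂))` is homogeneous. -/
theorem conical_surface_homogeneous
    (K : Type*) [Field K] [IsAlgClosed K] [CharZero K]
    (ι₁ ι₂ : RatFunc K →ₐ[K] Lfield K)
    (hι₁ : ι₁ RatFunc.X = t₁ K) (hι₂ : ι₂ RatFunc.X = t₂ K)
    (f : MvPolynomial (Fin 3) K) (w : Fin 3 → RatFunc K)
    (hpar : Parametrizes f (fun i => t₁ K * ι₂ (w i))) :
    f.IsHomogeneous f.totalDegree := by
  have hdil (g : MvPolynomial (Fin 3) K) (d : ℕ) (hg : g.IsHomogeneous d) :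
      MvPolynomial.aeval (fun i => t₁ K * ι₂ (w i)) g =
        t₁ K ^ d * ι₂ (MvPolynomial.aeval w g) := by
    rw [MvPolynomial.aeval_mul_left_of_isHomogeneous hg, MvPolynomial.comp_aeval_apply]
  have hzero := (hpar f).mpr dvd_rfl
  conv at hzero =>
    lhs
    rw [← MvPolynomial.sum_homogeneousComponent f]
  simp only [map_sum, hdil _ _ (MvPolynomial.homogeneousComponent_isHomogeneous _ f)] at hzero
  apply isHomogeneous_of_dvd_homogeneousComponent_totalDegree
  rw [← hpar, hdil _ _ (MvPolynomial.homogeneousComponent_isHomogeneous _ f),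
    eq_zero_of_sum_t₁_pow_mul_eq_zero ι₂ hι₂ _ _ hzero (Finset.self_mem_range_succ _),
    map_zero, mul_zero]
end
end
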